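/- Let d ≥ 2 be an integer and ε ∈ (0,1). If n ≥ 2 d³ ln(80 d) / ε⁴, then a random ε-nearly equal-norm and ε-nearly Parseval frame (x_i)_{i=1}^n drawn from the uniform measure ν on ℱ_{d,n}^ε satisfies inf over (y_i)_{i=1}^n ∈ ℱ_{d,n} of Σ_{i=1}^n ‖x_i − y_i‖² ≤ (sqrt(20)+sqrt(2))² ε² d with probability at least 0.95; and if n ≥ 2 d³ ln(400 d) / ε⁴, the same bound holds with probability at least 0.99. -/

import Mathlib

open MeasureTheory ProbabilityTheory Real

noncomputable section

/-- The frame operator `S v = ∑ i, ⟪x i, v⟫ • x i` of a finite family of vectors in `ℝ^d`,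
as a continuous linear map on Euclidean space. -/
def frameOperator {d n : ℕ} (x : Fin n → EuclideanSpace ℝ (Fin d)) :
    EuclideanSpace ℝ (Fin d) →L[ℝ] EuclideanSpace ℝ (Fin d) :=
  ∑ i, (innerSL ℝ (x i)).smulRight (x i)

/-- The spherical shell `S_ε^d = {v ∈ ℝ^d : (1-ε)(d/n) ≤ ‖v‖² ≤ (1+ε)(d/n)}`. -/
def sphericalShell (d n : ℕ) (ε : ℝ) : Set (EuclideanSpace ℝ (Fin d)) :=
  {v | (1 - ε) * ((d : ℝ) / n) ≤ ‖v‖ ^ 2 ∧ ‖v‖ ^ 2 ≤ (1 + ε) * ((d : ℝ) / n)}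

/-- The set `ℱ_{d,n}` of equal-norm Parseval frames: `S = I_d` and `‖x_i‖² = d/n`. -/
def equalNormParseval (d n : ℕ) : Set (Fin n → EuclideanSpace ℝ (Fin d)) :=
  {y | frameOperator y = 1 ∧ ∀ i, ‖y i‖ ^ 2 = (d : ℝ) / n}

/-- The squared distance from a frame `x` to the set `ℱ_{d,n}` of equal-norm Parseval
frames: `inf_{y ∈ ℱ_{d,n}} ∑ i, ‖x_i - y_i‖²`. -/
def paulsenDistSq {d n : ℕ} (x : Fin n → EuclideanSpace ℝ (Fin d)) : ℝ :=
  ⨅ y : equalNormParseval d n, ∑ i, ‖x i - (y : Fin n → EuclideanSpace ℝ (Fin d)) i‖ ^ 2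

/-- The uniform measure `ν` on `ℱ_{d,n}^ε`: the `n`-fold product of the uniform measure
on the shell `S_ε^d`, conditioned on the event that the tuple is ε-nearly Parseval. -/
def nearlyENPFMeasure (d n : ℕ) (ε : ℝ) :
    Measure (Fin n → EuclideanSpace ℝ (Fin d)) :=
  (Measure.pi fun _ : Fin n =>
      (volume : Measure (EuclideanSpace ℝ (Fin d)))[|sphericalShell d n ε])[|
    {x | ‖frameOperator x - 1‖ ≤ ε}]


/-- weighted frame matrix -/
def wMat {d n : ℕ} (u : Fin n → Fin d → ℝ) (c : Fin n → ℝ) : Matrix (Fin d) (Fin d) ℝ :=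
  ∑ i, c i • Matrix.vecMulVec (u i) (u i)

lemma det_rankone {d : ℕ} (A : Matrix (Fin d) (Fin d) ℝ) (hA : A.PosDef) (w : ℝ) (u : Fin d → ℝ) :
    (A + w • Matrix.vecMulVec u u).det = A.det * (1 + w * (u ⬝ᵥ (A⁻¹.mulVec u))) := by
  have hu : IsUnit A.det := hA.det_pos.ne'.isUnit
  have h := Matrix.det_add_replicateCol_mul_replicateRow (ι := Unit) hu (w • u) u
  have e1 : Matrix.replicateCol Unit (w • u) * Matrix.replicateRow Unit u
      = w • Matrix.vecMulVec u u := by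
    ext i j
    simp [Matrix.mul_apply, Matrix.vecMulVec_apply, mul_assoc]
  rw [e1] at h
  rw [h]
  congr 1
  rw [Matrix.det_unique]
  simp [Matrix.mul_apply, dotProduct, Matrix.mulVec, Finset.mul_sum, Finset.sum_mul]
  rw [Finset.sum_comm]
  refine Finset.sum_congr rfl fun i _ => Finset.sum_congr rfl fun j _ => by ring

lemma rankone_step {d : ℕ} (A : Matrix (Fin d) (Fin d) ℝ) (hA : A.PosDef) (w : ℝ) (hw : 0 ≤ w)
    (u : Fin d → ℝ) :
    (A + w • Matrix.vecMulVec u u).PosDef ∧ A.det ≤ (A + w • Matrix.vecMulVec u u).det := by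
  constructor
  · apply hA.add_posSemidef
    have := Matrix.posSemidef_vecMulVec_self_star u
    simp at this
    exact this.smul hw
  · rw [det_rankone A hA]
    have := hA.inv.posSemidef.dotProduct_mulVec_nonneg u
    simp at this
    nlinarith [hA.det_pos, mul_nonneg hA.det_pos.le (mul_nonneg hw this)]

lemma sum_step {d n : ℕ} (u : Fin n → Fin d → ℝ) (c : Fin n → ℝ) (hc : ∀ i, 0 < c i)
    (A : Matrix (Fin d) (Fin d) ℝ) (hA : A.PosDef) (J : Finset (Fin n)) :
    (A + ∑ i ∈ J, c i • Matrix.vecMulVec (u i) (u i)).PosDef ∧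
      A.det ≤ (A + ∑ i ∈ J, c i • Matrix.vecMulVec (u i) (u i)).det := by
  induction J using Finset.induction_on with
  | empty => simpa using hA
  | insert a s ha ih =>
    rw [Finset.sum_insert ha, add_comm (c a • _), ← add_assoc]
    have := rankone_step _ ih.1 (c a) (hc a).le (u a)
    exact ⟨this.1, ih.2.trans this.2⟩

/-- all d-subsets independent -/
def Generic {d n : ℕ} (u : Fin n → Fin d → ℝ) : Prop :=
  ∀ s : Fin d → Fin n, Function.Injective s → (Matrix.of fun j => u (s j)).det ≠ 0

lemma base_step {d n : ℕ} (u : Fin n → Fin d → ℝ) (c : Fin n → ℝ) (hc : ∀ i, 0 < c i)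
    (s : Fin d → Fin n) (hs : (Matrix.of fun j => u (s j)).det ≠ 0) :
    (∑ j, c (s j) • Matrix.vecMulVec (u (s j)) (u (s j))).PosDef ∧
    (∑ j, c (s j) • Matrix.vecMulVec (u (s j)) (u (s j))).det =
      (∏ j, c (s j)) * (Matrix.of fun j => u (s j)).det ^ 2 := by
  set U := (Matrix.of fun j => u (s j)) with hU
  have e : (∑ j, c (s j) • Matrix.vecMulVec (u (s j)) (u (s j))) =
      U.transpose * Matrix.diagonal (fun j => c (s j)) * U := by
    ext k l
    simp [Matrix.sum_apply, Matrix.mul_apply, Matrix.vecMulVec_apply, Matrix.diagonal_apply, hU]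
    refine Finset.sum_congr rfl fun i _ => by ring
  have hdet : (∑ j, c (s j) • Matrix.vecMulVec (u (s j)) (u (s j))).det =
      (∏ j, c (s j)) * U.det ^ 2 := by
    rw [e, Matrix.det_mul, Matrix.det_mul, Matrix.det_transpose, Matrix.det_diagonal]; ring
  refine ⟨?_, hdet⟩
  have hps : (∑ j, c (s j) • Matrix.vecMulVec (u (s j)) (u (s j))).PosSemidef := by
    apply Matrix.posSemidef_sum
    intro i _
    have := Matrix.posSemidef_vecMulVec_self_star (u (s i))
    simp at this
    exact this.smul (hc _).le
  rw [hps.posDef_iff_isUnit, Matrix.isUnit_iff_isUnit_det, hdet, isUnit_iff_ne_zero]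
  exact mul_ne_zero (Finset.prod_ne_zero_iff.mpr fun i _ => (hc _).ne') (pow_ne_zero _ hs)

lemma wMat_lower {d n : ℕ} (u : Fin n → Fin d → ℝ) (c : Fin n → ℝ) (hc : ∀ i, 0 < c i)
    (s : Fin d → Fin n) (hinj : Function.Injective s) (hs : (Matrix.of fun j => u (s j)).det ≠ 0) :
    (wMat u c).PosDef ∧ (∏ j, c (s j)) * (Matrix.of fun j => u (s j)).det ^ 2 ≤ (wMat u c).det := by
  obtain ⟨h1, h2⟩ := base_step u c hc s hs
  have h := sum_step u c hc _ h1 (Finset.univ \ Finset.univ.image s)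
  have e : wMat u c = ∑ j, c (s j) • Matrix.vecMulVec (u (s j)) (u (s j)) +
      ∑ i ∈ (Finset.univ \ Finset.univ.image s), c i • Matrix.vecMulVec (u i) (u i) := by
    rw [wMat, ← Finset.sum_sdiff (Finset.subset_univ (Finset.univ.image s)), add_comm]
    congr 1
    rw [Finset.sum_image (fun a _ b _ hab => hinj hab)]
  rw [e, ← h2]
  exact h

/-- combinatorial coercivity -/
lemma coercive_bound {d n : ℕ} (hd : 1 ≤ d) (hn : d < n) (t : Fin n → ℝ) (h0 : ∑ i, t i = 0) (L : ℝ)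
    (hL : ∀ I : Finset (Fin n), I.card = d → ∑ i ∈ I, t i ≤ L) (i : Fin n) : t i ≤ (d + 1) * L := by
  classical
  have hne : ((Finset.univ : Finset (Fin n)).powersetCard d).Nonempty := by
    rw [Finset.powersetCard_nonempty]; simp; omega
  obtain ⟨I, hI, hmax⟩ := Finset.exists_max_image _ (fun I => ∑ i ∈ I, t i) hne
  rw [Finset.mem_powersetCard] at hI
  have hIc := hI.2
  have hex : ∀ l ∈ I, ∀ j ∉ I, t j ≤ t l := by
    intro l hl j hj
    have hj' : j ∉ I.erase l := fun h => hj (Finset.mem_of_mem_erase h)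
    have := hmax (insert j (I.erase l)) (by
      rw [Finset.mem_powersetCard]; refine ⟨Finset.subset_univ _, ?_⟩
      rw [Finset.card_insert_of_notMem hj', Finset.card_erase_of_mem hl]; omega)
    rw [Finset.sum_insert hj'] at this
    have h2 := Finset.add_sum_erase I t hl
    linarith
  have hIne : I.Nonempty := by rw [← Finset.card_pos]; omega
  obtain ⟨l, hl, hlmin⟩ := Finset.exists_min_image I t hIne
  set τ := t l
  set S := ∑ i ∈ I, t i with hS
  have hSL : S ≤ L := hL I hIc
  have hcompl : S + ∑ i ∈ Iᶜ, t i = 0 := by rw [hS, Finset.sum_add_sum_compl, h0]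
  have hc1 : ∑ i ∈ Iᶜ, t i ≤ (n - d : ℝ) * τ := by
    have := Finset.sum_le_card_nsmul Iᶜ t τ (fun j hj => hex l hl j (by simpa using hj))
    rw [Finset.card_compl, hIc, Fintype.card_fin, nsmul_eq_mul, Nat.cast_sub hn.le] at this
    exact this
  have hSd : (d : ℝ) * τ ≤ S := by
    have := Finset.card_nsmul_le_sum I t τ hlmin
    rwa [hIc, nsmul_eq_mul] at this
  have hnd : (1 : ℝ) ≤ n - d := by
    have : ((d + 1 : ℕ) : ℝ) ≤ n := by exact_mod_cast hn
    push_cast at this; linarith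
  have hd' : (1 : ℝ) ≤ d := by exact_mod_cast hd
  have hSnn : 0 ≤ S := by
    by_contra hneg
    push Not at hneg
    have : τ < 0 := by nlinarith
    nlinarith
  have hτ : -S ≤ τ := by
    by_contra hneg
    push Not at hneg
    nlinarith
  have hLnn : 0 ≤ L := hSnn.trans hSL
  by_cases hi : i ∈ I
  · have h2 := Finset.add_sum_erase I t hi
    have h3 := Finset.card_nsmul_le_sum (I.erase i) t τ (fun j hj => hlmin j (Finset.mem_of_mem_erase hj))
    rw [Finset.card_erase_of_mem hi, hIc, nsmul_eq_mul, Nat.cast_sub hd] at h3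
    push_cast at h3
    nlinarith
  · have := hex l hl i hi
    have h4 : τ ≤ S := by nlinarith
    nlinarith


lemma exists_minimizer {d n : ℕ} (hd : 1 ≤ d) (hn : d < n) (u : Fin n → Fin d → ℝ)
    (hu : Generic u) : ∃ t : Fin n → ℝ, ∀ t' : Fin n → ℝ,
      Real.log (wMat u (fun i => Real.exp (t i))).det - (d / n : ℝ) * ∑ i, t i ≤
      Real.log (wMat u (fun i => Real.exp (t' i))).det - (d / n : ℝ) * ∑ i, t' i := by
  classical
  have hn0 : (0 : ℝ) < n := by exact_mod_cast (by omega : 0 < n)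
  let D : (Fin n → ℝ) → ℝ := fun t => (wMat u (fun i => Real.exp (t i))).det
  have hs0 : Function.Injective (fun j : Fin d => (Fin.castLE hn.le j)) := Fin.castLE_injective _
  have hDpos : ∀ t, 0 < D t := fun t =>
    (wMat_lower u _ (fun i => Real.exp_pos (t i)) _ hs0 (hu _ hs0)).1.det_pos
  have hDcont : Continuous D := by
    apply Continuous.matrix_det
    unfold wMat
    fun_prop
  have hlogc : Continuous (fun t => Real.log (D t)) := hDcont.log (fun t => (hDpos t).ne')
  -- lower bound constant
  obtain ⟨L, hL⟩ : ∃ L : ℝ, ∀ t, Real.log (D t) ≤ Real.log (D 0) →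
      ∀ I : Finset (Fin n), I.card = d → ∑ i ∈ I, t i ≤ L := by
    let m : Finset (Fin n) → ℝ := fun I => if h : I.card = d then
      Real.log (D 0) - Real.log ((Matrix.of fun j => u (I.orderEmbOfFin h j)).det ^ 2) else 0
    refine ⟨∑ I, |m I|, fun t ht I hI => ?_⟩
    have hinj : Function.Injective (fun j => I.orderEmbOfFin hI j) :=
      (I.orderEmbOfFin hI).injective
    have h1 := (wMat_lower u _ (fun i => Real.exp_pos (t i)) _ hinj (hu _ hinj)).2
    have h2 : Real.log ((∏ j, Real.exp (t (I.orderEmbOfFin hI j))) *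
        (Matrix.of fun j => u (I.orderEmbOfFin hI j)).det ^ 2) ≤ Real.log (D t) :=
      Real.log_le_log (mul_pos (Finset.prod_pos fun _ _ => Real.exp_pos _)
        (by have := hu _ hinj; positivity)) h1
    rw [← Real.exp_sum, Real.log_mul (Real.exp_pos _).ne' (pow_ne_zero _ (hu _ hinj)),
      Real.log_exp] at h2
    have h3 : ∑ j, t (I.orderEmbOfFin hI j) = ∑ i ∈ I, t i := by
      conv_rhs => rw [← Finset.image_orderEmbOfFin_univ I hI]
      rw [Finset.sum_image (fun a _ b _ hab => hinj hab)]
    rw [h3] at h2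
    have h4 : m I = Real.log (D 0) -
      Real.log ((Matrix.of fun j => u (I.orderEmbOfFin hI j)).det ^ 2) := by simp [m, hI]
    have h5 : |m I| ≤ ∑ I, |m I| :=
      Finset.single_le_sum (f := fun I => |m I|) (fun _ _ => abs_nonneg _) (Finset.mem_univ I)
    linarith [le_abs_self (m I)]
  let R : ℝ := n * |(d + 1) * L|
  let K : Set (Fin n → ℝ) := {t | ∑ i, t i = 0} ∩ Metric.closedBall 0 R
  have hRnn : 0 ≤ R := by positivity
  have hK : IsCompact K := by
    apply IsCompact.inter_left (isCompact_closedBall _ _)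
    exact isClosed_eq (by fun_prop) continuous_const
  obtain ⟨t, htK, htmin⟩ := hK.exists_isMinOn ⟨0, by simp [K, hRnn]⟩ hlogc.continuousOn
  have hmin0 : ∀ t', ∑ i, t' i = 0 → Real.log (D t) ≤ Real.log (D t') := by
    intro t' h0
    by_cases hle : Real.log (D t') ≤ Real.log (D 0)
    · apply htmin
      refine ⟨h0, ?_⟩
      have hup : ∀ i, t' i ≤ (d + 1) * L :=
        coercive_bound hd hn t' h0 L (hL t' hle)
      rw [mem_closedBall_zero_iff, pi_norm_le_iff_of_nonneg hRnn]
      intro i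
      have ha := le_abs_self ((d + 1) * L)
      have hn1 : (1 : ℝ) ≤ n := by exact_mod_cast (by omega : 1 ≤ n)
      rw [Real.norm_eq_abs, abs_le]
      constructor
      · have h2 := Finset.add_sum_erase Finset.univ t' (Finset.mem_univ i)
        have h3 := Finset.sum_le_card_nsmul (Finset.univ.erase i) t' _ (fun j _ => hup j)
        rw [Finset.card_erase_of_mem (Finset.mem_univ i), Finset.card_univ, Fintype.card_fin,
          nsmul_eq_mul, Nat.cast_sub (by omega)] at h3
        push_cast at h3
        simp only [R]
        nlinarith [abs_nonneg ((d + 1) * L)]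
      · simp only [R]
        nlinarith [hup i, abs_nonneg ((d + 1) * L)]
    · have : Real.log (D t) ≤ Real.log (D 0) := htmin (by simp [K, hRnn])
      linarith
  refine ⟨t, fun t' => ?_⟩
  set a : ℝ := (∑ i, t' i) / n with ha
  have hsum : ∑ i, (t' i - a) = 0 := by
    simp [Finset.sum_sub_distrib, ha]; field_simp; simp
  have h1 := hmin0 (fun i => t' i - a) hsum
  have h2 : D (fun i => t' i - a) = Real.exp (-a) ^ d * D t' := by
    have : wMat u (fun i => Real.exp (t' i - a)) =
        Real.exp (-a) • wMat u (fun i => Real.exp (t' i)) := by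
      unfold wMat
      rw [Finset.smul_sum]
      refine Finset.sum_congr rfl fun i _ => ?_
      rw [smul_smul, ← Real.exp_add]; congr 2; ring_nf
    simp only [D]
    rw [this, Matrix.det_smul]; simp
  rw [h2, Real.log_mul (by positivity) (hDpos _).ne', Real.log_pow, Real.log_exp] at h1
  have h3 : ∑ i, t i = 0 := htK.1
  rw [h3]
  have h4 : (d / n : ℝ) * ∑ i, t' i = d * a := by rw [ha]; ring
  rw [h4]
  simp only [D] at h1
  linarith

lemma exists_radial {d n : ℕ} (hd : 1 ≤ d) (hn : d < n) (u : Fin n → Fin d → ℝ)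
    (hu : Generic u) : ∃ c : Fin n → ℝ, (∀ i, 0 < c i) ∧ (wMat u c).PosDef ∧
      ∀ i, c i * (u i ⬝ᵥ ((wMat u c)⁻¹.mulVec (u i))) = (d / n : ℝ) := by
  classical
  obtain ⟨t, ht⟩ := exists_minimizer hd hn u hu
  set c : Fin n → ℝ := fun i => Real.exp (t i) with hc
  have hs0 : Function.Injective (fun j : Fin d => (Fin.castLE hn.le j)) := Fin.castLE_injective _
  have hcpos : ∀ i, 0 < c i := fun i => Real.exp_pos (t i)
  have hPD := (wMat_lower u c hcpos _ hs0 (hu _ hs0)).1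
  refine ⟨c, hcpos, hPD, fun i => ?_⟩
  set a := c i * (u i ⬝ᵥ ((wMat u c)⁻¹.mulVec (u i))) with ha
  -- vary coordinate i
  have key : ∀ s : ℝ, Real.log (wMat u c).det - (d / n : ℝ) * ∑ i, t i ≤
      Real.log ((wMat u c).det * (1 + (Real.exp s - 1) * a)) - (d / n : ℝ) * (∑ i, t i + s) := by
    intro s
    have h := ht (Function.update t i (t i + s))
    have e1 : ∑ j, Function.update t i (t i + s) j = ∑ j, t j + s := by
      rw [Finset.sum_update_of_mem (Finset.mem_univ i),
        ← Finset.add_sum_erase Finset.univ t (Finset.mem_univ i), Finset.sdiff_singleton_eq_erase]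
      ring
    have e2 : wMat u (fun j => Real.exp (Function.update t i (t i + s) j)) =
        wMat u c + (c i * (Real.exp s - 1)) • Matrix.vecMulVec (u i) (u i) := by
      unfold wMat
      rw [← Finset.add_sum_erase Finset.univ _ (Finset.mem_univ i),
        ← Finset.add_sum_erase Finset.univ (fun i => c i • _) (Finset.mem_univ i)]
      rw [add_right_comm]
      congr 1
      · simp only [Function.update_self, Real.exp_add, hc, ← add_smul]
        congr 1; ring
      · refine Finset.sum_congr rfl fun j hj => ?_
        simp only [Function.update_of_ne (Finset.ne_of_mem_erase hj), hc]
    rw [e1, e2, det_rankone _ hPD] at h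
    have e3 : c i * (Real.exp s - 1) * (u i ⬝ᵥ ((wMat u c)⁻¹.mulVec (u i))) =
      (Real.exp s - 1) * a := by rw [ha]; ring
    rwa [e3] at h
  let F : ℝ → ℝ := fun s =>
    Real.log ((wMat u c).det * (1 + (Real.exp s - 1) * a)) - (d / n : ℝ) * (∑ i, t i + s)
  have hF0 : IsLocalMin F 0 := by
    apply Filter.Eventually.of_forall
    intro s
    simpa [F] using key s
  have hD : HasDerivAt F (a - d / n) 0 := by
    have h1 : HasDerivAt (fun s : ℝ => (wMat u c).det * (1 + (Real.exp s - 1) * a))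
        ((wMat u c).det * (Real.exp 0 * a)) 0 :=
      ((((Real.hasDerivAt_exp 0).sub_const 1).mul_const a).const_add 1).const_mul _
    have h2 := h1.log (by simp [hPD.det_pos.ne'])
    have h3 : HasDerivAt (fun s : ℝ => (d / n : ℝ) * (∑ i, t i + s)) ((d / n : ℝ) * 1) 0 :=
      ((hasDerivAt_id (0 : ℝ)).const_add _).const_mul _
    have h4 := h2.sub h3
    have e4 : (wMat u c).det * (Real.exp 0 * a) / ((wMat u c).det * (1 + (Real.exp 0 - 1) * a))
        - (d / n : ℝ) * 1 = a - d / n := by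
      have := hPD.det_pos.ne'
      simp
      field_simp
    rw [e4] at h4
    exact h4
  have := hF0.hasDerivAt_eq_zero hD
  linarith


lemma exists_eigen_radial {d n : ℕ} (hd : 1 ≤ d) (hn : d < n)
    (x : Fin n → EuclideanSpace ℝ (Fin d)) (hu : Generic (fun i => (x i : Fin d → ℝ))) :
    ∃ (b : OrthonormalBasis (Fin d) ℝ (EuclideanSpace ℝ (Fin d))) (q : Fin d → ℝ) (γ : Fin n → ℝ),
      (∀ j, 0 < q j) ∧ Monotone q ∧ (∀ i, 0 < γ i) ∧
      (∀ j k, ∑ i, γ i * inner ℝ (b j) (x i) * inner ℝ (b k) (x i) = if j = k then q j else 0) ∧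
      ∀ i, γ i * ∑ j, inner ℝ (b j) (x i) ^ 2 / q j = (d / n : ℝ) := by
  classical
  obtain ⟨c, hc, hPD, hrad⟩ := exists_radial hd hn _ hu
  set Q := wMat (fun i => (x i : Fin d → ℝ)) c with hQ
  let b0 := hPD.isHermitian.eigenvectorBasis
  let l := hPD.isHermitian.eigenvalues
  have hl : ∀ j, 0 < l j := hPD.eigenvalues_pos
  have hb0 : ∀ j, Q.mulVec (b0 j) = l j • (b0 j : Fin d → ℝ) :=
    fun j => hPD.isHermitian.mulVec_eigenvectorBasis j
  let σ := Tuple.sort l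
  let b := b0.reindex σ.symm
  let q := l ∘ σ
  have hb : ∀ j, Q.mulVec (b j) = q j • (b j : Fin d → ℝ) := by
    intro j; simp [b, q, hb0]
  have hin : ∀ v w : EuclideanSpace ℝ (Fin d), inner ℝ v w = (v : Fin d → ℝ) ⬝ᵥ (w : Fin d → ℝ) := by
    intro v w
    rw [EuclideanSpace.inner_eq_star_dotProduct, dotProduct_comm]; simp
  have hQt : Q.transpose = Q := by
    have := hPD.isHermitian.eq
    rwa [Matrix.conjTranspose_eq_transpose_of_trivial] at this
  refine ⟨b, q, c, fun j => hl _, Tuple.monotone_sort l, hc, ?_, ?_⟩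
  · intro j k
    have h1 : (b j : Fin d → ℝ) ⬝ᵥ Q.mulVec (b k) =
        ∑ i, c i * inner ℝ (b j) (x i) * inner ℝ (b k) (x i) := by
      rw [hQ, wMat, Matrix.sum_mulVec, dotProduct_sum]
      refine Finset.sum_congr rfl fun i _ => ?_
      rw [Matrix.smul_mulVec, Matrix.vecMulVec_mulVec, hin, hin]
      simp [dotProduct_smul, dotProduct_comm]
      ring
    rw [← h1, hb, dotProduct_smul, ← hin, b.inner_eq_ite]
    split_ifs with h
    · simp [h]
    · simp
  · intro i
    rw [← hrad i]
    congr 1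
    set y : Fin d → ℝ := Q⁻¹.mulVec (x i) with hy
    have hQy : Q.mulVec y = x i := by
      rw [hy, Matrix.mulVec_mulVec, Matrix.mul_nonsing_inv _ hPD.det_pos.ne'.isUnit,
        Matrix.one_mulVec]
    let Y : EuclideanSpace ℝ (Fin d) := WithLp.toLp 2 y
    have h1 : ∀ j, inner ℝ (b j) (x i) = q j * inner ℝ (b j) Y := by
      intro j
      rw [hin, hin, ← hQy, Matrix.dotProduct_mulVec, ← Matrix.mulVec_transpose, hQt, hb,
        smul_dotProduct]
      rfl
    have h2 : (x i : Fin d → ℝ) ⬝ᵥ y = inner ℝ (x i) Y := (hin (x i) Y).symm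
    rw [h2, ← b.sum_inner_mul_inner (x i) Y]
    refine Finset.sum_congr rfl fun j _ => ?_
    have : q j ≠ 0 := (hl _).ne'
    rw [real_inner_comm (b j) (x i), h1 j]
    field_simp

/-- squared Frobenius norm of `S - c`. -/
def frob {d n : ℕ} (x : Fin n → EuclideanSpace ℝ (Fin d)) (c : ℝ) : ℝ :=
  ∑ i, ∑ i', inner ℝ (x i) (x i') ^ 2 - 2 * c * ∑ i, ‖x i‖ ^ 2 + c ^ 2 * d

lemma frob_eq {d n : ℕ} (x : Fin n → EuclideanSpace ℝ (Fin d)) (c : ℝ)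
    (b : OrthonormalBasis (Fin d) ℝ (EuclideanSpace ℝ (Fin d))) :
    frob x c = ∑ j, ∑ k, (∑ i, inner ℝ (b j) (x i) * inner ℝ (b k) (x i)
      - if j = k then c else 0) ^ 2 := by
  classical
  have h1 : ∑ j, ∑ k, (∑ i, inner ℝ (b j) (x i) * inner ℝ (b k) (x i)) ^ 2 =
      ∑ i, ∑ i', inner ℝ (x i) (x i') ^ 2 := by
    have e : ∀ i i', inner ℝ (x i) (x i') = ∑ j, inner ℝ (b j) (x i) * inner ℝ (b j) (x i') := by
      intro i i'
      rw [← b.sum_inner_mul_inner (x i) (x i')]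
      refine Finset.sum_congr rfl fun j _ => by rw [real_inner_comm]
    simp only [e, sq, Finset.sum_mul_sum]
    have : ∀ f : Fin d → Fin d → Fin n → Fin n → ℝ, ∑ j, ∑ k, ∑ i, ∑ i', f j k i i' =
        ∑ i, ∑ i', ∑ j, ∑ k, f j k i i' := by
      intro f
      calc ∑ j, ∑ k, ∑ i, ∑ i', f j k i i' = ∑ j, ∑ i, ∑ k, ∑ i', f j k i i' := by
            refine Finset.sum_congr rfl fun j _ => Finset.sum_comm
        _ = ∑ i, ∑ j, ∑ k, ∑ i', f j k i i' := Finset.sum_comm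
        _ = ∑ i, ∑ j, ∑ i', ∑ k, f j k i i' := by
            refine Finset.sum_congr rfl fun i _ => Finset.sum_congr rfl fun j _ => Finset.sum_comm
        _ = _ := by
            refine Finset.sum_congr rfl fun i _ => Finset.sum_comm
    rw [this]
    refine Finset.sum_congr rfl fun i _ => Finset.sum_congr rfl fun i' _ =>
      Finset.sum_congr rfl fun j _ => Finset.sum_congr rfl fun k _ => by ring
  have h2 : ∑ i, ‖x i‖ ^ 2 = ∑ j, ∑ i, inner ℝ (b j) (x i) * inner ℝ (b j) (x i) := by
    rw [Finset.sum_comm]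
    refine Finset.sum_congr rfl fun i _ => ?_
    rw [← b.sum_sq_inner_right (x i)]
    refine Finset.sum_congr rfl fun j _ => by ring
  have h3 : ∀ j k, (∑ i, inner ℝ (b j) (x i) * inner ℝ (b k) (x i)
      - if j = k then c else 0) ^ 2 = (∑ i, inner ℝ (b j) (x i) * inner ℝ (b k) (x i)) ^ 2
      - (if j = k then 2 * c * (∑ i, inner ℝ (b j) (x i) * inner ℝ (b k) (x i)) - c ^ 2 else 0) := by
    intro j k
    split_ifs <;> ring
  simp only [h3, Finset.sum_sub_distrib, Finset.sum_ite_eq, Finset.mem_univ, if_true]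
  rw [h1, frob, h2, ← Finset.mul_sum]
  simp
  ring

lemma frob_nonneg {d n : ℕ} (x : Fin n → EuclideanSpace ℝ (Fin d)) (c : ℝ) : 0 ≤ frob x c := by
  rw [frob_eq x c (EuclideanSpace.basisFun _ _)]
  positivity

lemma frameOperator_apply {d n : ℕ} (x : Fin n → EuclideanSpace ℝ (Fin d))
    (v : EuclideanSpace ℝ (Fin d)) : frameOperator x v = ∑ i, inner ℝ (x i) v • x i := by
  simp [frameOperator]

lemma frameOperator_eq_one {d n : ℕ} (y : Fin n → EuclideanSpace ℝ (Fin d))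
    (b : OrthonormalBasis (Fin d) ℝ (EuclideanSpace ℝ (Fin d)))
    (h : ∀ j k, ∑ i, inner ℝ (b j) (y i) * inner ℝ (b k) (y i) = if j = k then 1 else 0) :
    frameOperator y = 1 := by
  apply ContinuousLinearMap.coe_injective
  apply b.toBasis.ext
  intro j
  apply InnerProductSpace.ext_inner_left_basis (𝕜 := ℝ) b.toBasis
  intro k
  simp only [OrthonormalBasis.coe_toBasis, ContinuousLinearMap.coe_coe, frameOperator_apply,
    inner_sum, inner_smul_right, one_apply_eq_self]
  rw [b.inner_eq_ite, ← h k j]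
  refine Finset.sum_congr rfl fun i _ => ?_
  rw [real_inner_comm (y i) (b j)]; ring

lemma single_crossing {d : ℕ} (p θ : Fin d → ℝ) (hp : ∀ j, 0 ≤ p j) (hθ : Antitone θ)
    (h0 : ∑ j, p j * (θ j - 1) = 0) (k : ℕ) :
    0 ≤ ∑ j, if j.val < k then p j * (θ j - 1) else 0 := by
  by_cases h : ∀ j : Fin d, j.val < k → 1 ≤ θ j
  · refine Finset.sum_nonneg fun j _ => ?_
    split_ifs with hj
    · exact mul_nonneg (hp j) (by linarith [h j hj])
    · exact le_rfl
  · push Not at h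
    obtain ⟨j0, hj0, hθ0⟩ := h
    have hs : ∑ j, (if j.val < k then p j * (θ j - 1) else 0) +
        ∑ j, (if j.val < k then 0 else p j * (θ j - 1)) = 0 := by
      rw [← Finset.sum_add_distrib]
      refine (Finset.sum_congr rfl fun j _ => ?_).trans h0
      split_ifs <;> simp
    have h2 : ∑ j, (if j.val < k then 0 else p j * (θ j - 1)) ≤ 0 := by
      refine Finset.sum_nonpos fun j _ => ?_
      split_ifs with hj
      · exact le_rfl
      · have : θ j ≤ θ j0 := hθ (by rw [Fin.le_def]; omega)
        exact mul_nonpos_of_nonneg_of_nonpos (hp j) (by linarith)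
    linarith

lemma partial_sum_abs {d : ℕ} (a : Fin d → ℝ) (j : Fin d)
    (h : ∀ k : ℕ, 0 ≤ ∑ i, if i.val < k then a i else 0) :
    |a j| ≤ (∑ i, if i.val < j.val + 1 then a i else 0) + ∑ i, if i.val < j.val then a i else 0 := by
  have e : (∑ i, if i.val < j.val + 1 then a i else 0) =
      (∑ i, if i.val < j.val then a i else 0) + a j := by
    have : a j = ∑ i, if i = j then a i else 0 := by simp
    rw [this, ← Finset.sum_add_distrib]
    refine Finset.sum_congr rfl fun i _ => ?_
    rcases lt_trichotomy i.val j.val with h | h | h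
    · have h' : i ≠ j := fun e => by simp [e] at h
      simp [h, h', Nat.lt_succ_of_lt h]
    · have h' : i = j := Fin.ext h
      simp [h']
    · have h' : i ≠ j := fun e => by simp [e] at h
      have h1 : ¬ i.val < j.val := by omega
      have h2 : ¬ i.val < j.val + 1 := by omega
      simp [h1, h2, h']
  have h1 := h j.val
  have h2 := h (j.val + 1)
  rw [abs_le]; constructor <;> linarith

lemma hamilton_moitra {d n : ℕ} (hd : 1 ≤ d) (hn : d < n)
    (x : Fin n → EuclideanSpace ℝ (Fin d)) (hu : Generic (fun i => (x i : Fin d → ℝ)))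
    (hx : ∀ i, ‖x i‖ ^ 2 = (d : ℝ) / n) :
    ∃ y ∈ equalNormParseval d n, ∑ i, ‖x i - y i‖ ^ 2 ≤ 2 * d * √(d * frob x 1) := by
  obtain ⟨b, q, γ, hq, hmono, hγ, horth, hnorm⟩ := exists_eigen_radial hd hn x hu
  let p : Fin n → Fin d → ℝ := fun i j => inner ℝ (b j) (x i)
  let z : Fin n → Fin d → ℝ := fun i j => √(γ i / q j) * p i j
  let y : Fin n → EuclideanSpace ℝ (Fin d) := fun i => ∑ j, z i j • b j
  have hyz : ∀ i j, inner ℝ (b j) (y i) = z i j := by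
    intro i j
    simp only [y, inner_sum, inner_smul_right, b.inner_eq_ite]
    simp
  have hz2 : ∀ i j, z i j ^ 2 = p i j ^ 2 * (γ i / q j) := by
    intro i j
    simp only [z]
    rw [mul_pow, Real.sq_sqrt (div_pos (hγ i) (hq j)).le]; ring
  have hzsum : ∀ i, ∑ j, z i j ^ 2 = (d : ℝ) / n := by
    intro i
    rw [← hnorm i, Finset.mul_sum]
    refine Finset.sum_congr rfl fun j _ => ?_
    rw [hz2]; simp only [p]; ring
  have hpsum : ∀ i, ∑ j, p i j ^ 2 = (d : ℝ) / n := by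
    intro i
    rw [← hx i, ← b.sum_sq_inner_right (x i)]
  have hzorth : ∀ j k, ∑ i, z i j * z i k = if j = k then 1 else 0 := by
    intro j k
    have : ∑ i, z i j * z i k = (∑ i, γ i * p i j * p i k) / (√(q j) * √(q k)) := by
      rw [Finset.sum_div]
      refine Finset.sum_congr rfl fun i _ => ?_
      simp only [z]
      rw [Real.sqrt_div (hγ i).le, Real.sqrt_div (hγ i).le]
      have h1 := Real.sqrt_ne_zero'.mpr (hq j)
      have h2 := Real.sqrt_ne_zero'.mpr (hq k)
      field_simp
      rw [Real.sq_sqrt (hγ i).le]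
      ring
    rw [this, horth]
    split_ifs with h
    · subst h
      rw [Real.mul_self_sqrt (hq j).le, div_self (hq j).ne']
    · simp
  refine ⟨y, ⟨frameOperator_eq_one y b ?_, ?_⟩, ?_⟩
  · intro j k
    simp only [hyz, hzorth]
  · intro i
    rw [← b.sum_sq_inner_right (y i), ← hzsum i]
    simp only [hyz]
  -- main bound
  let A : Fin n → ℕ → ℝ := fun i k => ∑ j : Fin d, if j.val < k then (z i j ^ 2 - p i j ^ 2) else 0
  have hA : ∀ i k, 0 ≤ A i k := by
    intro i k
    have e : ∀ j, z i j ^ 2 - p i j ^ 2 = p i j ^ 2 * (γ i / q j - 1) := by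
      intro j; rw [hz2]; ring
    simp only [A, e]
    apply single_crossing
    · intro j; positivity
    · intro j k hjk
      exact div_le_div_of_nonneg_left (hγ i).le (hq j) (hmono hjk)
    · simp only [← e, Finset.sum_sub_distrib, hzsum, hpsum, sub_self]
  have hAsum : ∀ k, ∑ i, A i k ≤ √(d * frob x 1) := by
    intro k
    let e : Fin d → ℝ := fun j => ∑ i, p i j * p i j - 1
    have h1 : ∑ i, A i k = ∑ j : Fin d, if j.val < k then - e j else 0 := by
      simp only [A]
      rw [Finset.sum_comm]
      refine Finset.sum_congr rfl fun j _ => ?_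
      split_ifs
      · rw [Finset.sum_sub_distrib]
        have := hzorth j j
        simp only [if_true] at this
        simp only [sq, this, e]
        ring
      · simp
    have h2 : ∑ i, A i k ≤ ∑ j, |e j| := by
      rw [h1]
      refine Finset.sum_le_sum fun j _ => ?_
      split_ifs
      · exact neg_le_abs _
      · exact abs_nonneg _
    have h3 : (∑ j, |e j|) ^ 2 ≤ d * ∑ j, e j ^ 2 := by
      have := sq_sum_le_card_mul_sum_sq (s := Finset.univ) (f := fun j => |e j|)
      simpa using this
    have h4 : ∑ j, e j ^ 2 ≤ frob x 1 := by
      rw [frob_eq x 1 b]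
      refine Finset.sum_le_sum fun j _ => ?_
      have := Finset.single_le_sum (f := fun k => (∑ i, inner ℝ (b j) (x i) * inner ℝ (b k) (x i)
        - if j = k then (1:ℝ) else 0) ^ 2) (fun _ _ => sq_nonneg _) (Finset.mem_univ j)
      simpa [e, p] using this
    refine h2.trans (Real.le_sqrt_of_sq_le (h3.trans ?_))
    gcongr
  have hterm : ∀ i, ‖x i - y i‖ ^ 2 ≤ ∑ j : Fin d, (A i (j.val + 1) + A i j.val) := by
    intro i
    rw [← b.sum_sq_inner_right (x i - y i)]
    refine Finset.sum_le_sum fun j _ => ?_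
    have h1 := partial_sum_abs (fun j => z i j ^ 2 - p i j ^ 2) j (hA i)
    refine le_trans ?_ h1
    rw [inner_sub_right, hyz]
    change (p i j - z i j) ^ 2 ≤ |z i j ^ 2 - p i j ^ 2|
    have hθ := Real.sqrt_nonneg (γ i / q j)
    simp only [z]
    set θ := √(γ i / q j)
    rcases le_total 1 θ with h | h
    · refine le_trans ?_ (le_abs_self _)
      nlinarith [mul_nonneg (sq_nonneg (p i j)) (sub_nonneg.mpr h)]
    · refine le_trans ?_ (neg_le_abs _)
      nlinarith [mul_nonneg (mul_nonneg (sq_nonneg (p i j)) (sub_nonneg.mpr h)) hθ]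
  calc ∑ i, ‖x i - y i‖ ^ 2 ≤ ∑ i, ∑ j : Fin d, (A i (j.val + 1) + A i j.val) :=
        Finset.sum_le_sum fun i _ => hterm i
    _ = ∑ j : Fin d, (∑ i, A i (j.val + 1) + ∑ i, A i j.val) := by
        rw [Finset.sum_comm]
        refine Finset.sum_congr rfl fun j _ => Finset.sum_add_distrib
    _ ≤ ∑ j : Fin d, (√(d * frob x 1) + √(d * frob x 1)) :=
        Finset.sum_le_sum fun j _ => add_le_add (hAsum _) (hAsum _)
    _ = 2 * d * √(d * frob x 1) := by simp; ring


lemma generic_eventually {d n : ℕ} (u : Fin n → Fin d → ℝ) :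
    ∀ᶠ t in nhdsWithin (0:ℝ) {0}ᶜ, Generic (fun i k => u i k + t * (i.val : ℝ) ^ k.val) := by
  classical
  unfold Generic
  rw [Filter.eventually_all]
  intro s
  by_cases hs : Function.Injective s
  swap
  · exact Filter.Eventually.of_forall fun t h => absurd h hs
  let A : Matrix (Fin d) (Fin d) ℝ := Matrix.vandermonde (fun j => ((s j).val : ℝ))
  let B : Matrix (Fin d) (Fin d) ℝ := Matrix.of fun j => u (s j)
  let P : Polynomial ℝ := ((Polynomial.X : Polynomial ℝ) • A.map Polynomial.C + B.map Polynomial.C).det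
  have hP : P ≠ 0 := by
    intro h
    have h1 := Polynomial.coeff_det_X_add_C_card A B
    change P.coeff _ = _ at h1
    rw [h, Polynomial.coeff_zero] at h1
    refine Matrix.det_vandermonde_ne_zero_iff.mpr ?_ h1.symm
    intro a b hab
    apply hs
    apply Fin.ext
    have hab' : ((s a).val : ℝ) = (s b).val := hab
    exact_mod_cast hab'
  have hfin : (P.rootSet ℝ).Finite := Polynomial.rootSet_finite P ℝ
  have hev : ∀ t, P.eval t = (Matrix.of fun j => (fun k : Fin d => u (s j) k + t * ((s j).val : ℝ) ^ k.val)).det := by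
    intro t
    have : P.eval t = (Polynomial.evalRingHom t) P := rfl
    rw [this, RingHom.map_det]
    congr 1
    ext j k
    simp [A, B, Matrix.vandermonde_apply]
    ring
  have h2 : ∀ᶠ t in nhdsWithin (0:ℝ) {0}ᶜ, P.eval t ≠ 0 := by
    by_cases h0 : P.eval 0 = 0
    · have : ∀ᶠ t in nhds (0:ℝ), t ∈ ((P.rootSet ℝ) \ {0})ᶜ :=
        (hfin.subset Set.sdiff_subset).isClosed.isOpen_compl.mem_nhds (by simp)
      filter_upwards [nhdsWithin_le_nhds this, self_mem_nhdsWithin] with t ht ht0 he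
      apply ht
      refine ⟨?_, ht0⟩
      rw [Polynomial.mem_rootSet]
      exact ⟨hP, by simpa using he⟩
    · exact nhdsWithin_le_nhds (P.continuous.continuousAt.eventually_ne h0)
  filter_upwards [h2] with t ht _
  rw [← hev]; exact ht

lemma generic_seq {d n : ℕ} (hd : 1 ≤ d) (hn : d < n) (u : Fin n → EuclideanSpace ℝ (Fin d))
    (hu : ∀ i, ‖u i‖ ^ 2 = (d : ℝ) / n) :
    ∃ v : ℝ → Fin n → EuclideanSpace ℝ (Fin d),
      Filter.Tendsto v (nhdsWithin (0:ℝ) {0}ᶜ) (nhds u) ∧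
      ∀ᶠ t in nhdsWithin (0:ℝ) {0}ᶜ, Generic (fun i => (v t i : Fin d → ℝ)) ∧
        ∀ i, ‖v t i‖ ^ 2 = (d : ℝ) / n := by
  have hdn : (0:ℝ) < d / n := div_pos (by exact_mod_cast hd) (by exact_mod_cast (by omega : 0 < n))
  let r : ℝ := √((d:ℝ) / n)
  have hr : 0 < r := Real.sqrt_pos.mpr hdn
  have hur : ∀ i, ‖u i‖ = r := fun i => by
    rw [← Real.sqrt_sq (norm_nonneg (u i)), hu i]
  let w : ℝ → Fin n → EuclideanSpace ℝ (Fin d) := fun t i =>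
    u i + t • WithLp.toLp 2 (fun k : Fin d => (i.val : ℝ) ^ k.val)
  have hw : Continuous w := by fun_prop
  have hw0 : w 0 = u := by ext i; simp [w]
  let v : ℝ → Fin n → EuclideanSpace ℝ (Fin d) := fun t i => (r * ‖w t i‖⁻¹) • w t i
  have hw00 : ∀ i, ‖w 0 i‖ ≠ 0 := fun i => by rw [hw0, hur]; exact hr.ne'
  have hcont : ContinuousAt v 0 := by
    rw [continuousAt_pi]
    intro i
    have h1 : ContinuousAt (fun t => w t i) 0 := ((continuous_apply i).comp hw).continuousAt
    exact (continuousAt_const.mul (h1.norm.inv₀ (hw00 i))).smul h1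
  have hv0 : v 0 = u := by
    funext i
    simp only [v, hw0, hur]
    rw [mul_inv_cancel₀ hr.ne', one_smul]
  refine ⟨v, ?_, ?_⟩
  · have := hcont.tendsto
    rw [hv0] at this
    exact this.mono_left nhdsWithin_le_nhds
  · have hne : ∀ᶠ t in nhdsWithin (0:ℝ) {0}ᶜ, ∀ i, ‖w t i‖ ≠ 0 := by
      have h0 : ∀ᶠ t in nhds (0:ℝ), ∀ i, ‖w t i‖ ≠ 0 := by
        rw [Filter.eventually_all]
        intro i
        exact (((continuous_apply i).comp hw).norm.continuousAt).eventually_ne (hw00 i)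
      exact nhdsWithin_le_nhds h0
    filter_upwards [hne, generic_eventually (fun i => (u i : Fin d → ℝ))] with t h1 h2
    constructor
    · intro s hs
      have h3 := h2 s hs
      have e : (Matrix.of fun j => (v t (s j) : Fin d → ℝ)) = Matrix.of fun j k =>
          (r * ‖w t (s j)‖⁻¹) * (Matrix.of fun j => (fun k : Fin d => u (s j) k + t * ((s j).val : ℝ) ^ k.val)) j k := by
        ext j k
        simp [v, w]
        ring
      rw [e, Matrix.det_mul_column]
      refine mul_ne_zero (Finset.prod_ne_zero_iff.mpr fun j _ => ?_) h3
      exact mul_ne_zero hr.ne' (inv_ne_zero (h1 _))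
    · intro i
      simp only [v]
      rw [norm_smul, mul_pow, Real.norm_eq_abs, sq_abs, mul_pow, inv_pow]
      have := h1 i
      field_simp
      exact Real.sq_sqrt hdn.le

lemma enpf_nonempty {d n : ℕ} (hd : 1 ≤ d) (hn : d < n) : (equalNormParseval d n).Nonempty := by
  have hdn : (0:ℝ) < d / n := div_pos (by exact_mod_cast hd) (by exact_mod_cast (by omega : 0 < n))
  have : ∃ e : EuclideanSpace ℝ (Fin d), ‖e‖ = √((d:ℝ) / n) := by
    refine ⟨EuclideanSpace.single ⟨0, hd⟩ (√((d:ℝ) / n)), ?_⟩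
    rw [PiLp.norm_single, Real.norm_eq_abs, abs_of_nonneg (Real.sqrt_nonneg _)]
  obtain ⟨e, he⟩ := this
  obtain ⟨v, _, hv⟩ := generic_seq hd hn (fun _ => e) (fun i => by rw [he, Real.sq_sqrt hdn.le])
  obtain ⟨t, ht⟩ := hv.exists
  obtain ⟨y, hy, _⟩ := hamilton_moitra hd hn _ ht.1 ht.2
  exact ⟨y, hy⟩

lemma paulsen_le_of_mem {d n : ℕ} (x y : Fin n → EuclideanSpace ℝ (Fin d))
    (hy : y ∈ equalNormParseval d n) : paulsenDistSq x ≤ ∑ i, ‖x i - y i‖ ^ 2 := by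
  have hb : BddBelow (Set.range fun y : equalNormParseval d n =>
      ∑ i, ‖x i - (y : Fin n → EuclideanSpace ℝ (Fin d)) i‖ ^ 2) :=
    ⟨0, by rintro _ ⟨y, rfl⟩; positivity⟩
  exact ciInf_le hb ⟨y, hy⟩

lemma paulsen_le {d n : ℕ} (hd : 1 ≤ d) (hn : d < n) (x u : Fin n → EuclideanSpace ℝ (Fin d))
    (hu : ∀ i, ‖u i‖ ^ 2 = (d : ℝ) / n) :
    paulsenDistSq x ≤ 4 * ∑ i, ‖x i - u i‖ ^ 2 + 4 / 3 * (2 * d * √(d * frob u 1)) := by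
  obtain ⟨v, hv, hev⟩ := generic_seq hd hn u hu
  have hc : Continuous (fun u : Fin n → EuclideanSpace ℝ (Fin d) =>
      4 * ∑ i, ‖x i - u i‖ ^ 2 + 4 / 3 * (2 * d * √(d * frob u 1))) := by
    unfold frob
    fun_prop
  refine ge_of_tendsto ((hc.tendsto u).comp hv) ?_
  filter_upwards [hev] with t ht
  obtain ⟨y, hy, hb⟩ := hamilton_moitra hd hn _ ht.1 ht.2
  refine (paulsen_le_of_mem x y hy).trans ?_
  have h1 : ∑ i, ‖x i - y i‖ ^ 2 ≤
      4 * ∑ i, ‖x i - v t i‖ ^ 2 + 4 / 3 * ∑ i, ‖v t i - y i‖ ^ 2 := by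
    rw [Finset.mul_sum, Finset.mul_sum, ← Finset.sum_add_distrib]
    refine Finset.sum_le_sum fun i _ => ?_
    have h2 : ‖x i - y i‖ ≤ ‖x i - v t i‖ + ‖v t i - y i‖ := norm_sub_le_norm_sub_add_norm_sub _ _ _
    have h3 := norm_nonneg (x i - y i)
    nlinarith [sq_nonneg (3 * ‖x i - v t i‖ - ‖v t i - y i‖)]
  refine h1.trans ?_
  simp only [Function.comp]
  gcongr


/-- rotation invariant measure, supported on `‖x‖² ≤ B` -/
structure RotBdd {d : ℕ} (μ : Measure (EuclideanSpace ℝ (Fin d))) (B : ℝ) : Prop where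
  inv : ∀ L : EuclideanSpace ℝ (Fin d) ≃ₗᵢ[ℝ] EuclideanSpace ℝ (Fin d), MeasurePreserving L μ μ
  bdd : ∀ᵐ x ∂μ, ‖x‖ ^ 2 ≤ B

namespace RotBdd
variable {d : ℕ} {μ : Measure (EuclideanSpace ℝ (Fin d))} {B : ℝ}

lemma integral_inner_eq (h : RotBdd μ B) (f : ℝ → ℝ) (v w : EuclideanSpace ℝ (Fin d))
    (hvw : ‖v‖ = ‖w‖) : ∫ x, f (inner ℝ x v) ∂μ = ∫ x, f (inner ℝ x w) ∂μ := by
  let L := (ℝ ∙ (v - w))ᗮ.reflection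
  have hL : L v = w := Submodule.reflection_sub hvw
  have h1 := (h.inv L).integral_comp L.toHomeomorph.measurableEmbedding (fun x => f (inner ℝ x w))
  rw [← h1]
  congr 1; ext x
  rw [← hL, LinearIsometryEquiv.inner_map_map]

lemma B_nonneg [IsProbabilityMeasure μ] (h : RotBdd μ B) : 0 ≤ B := by
  obtain ⟨x, hx⟩ := h.bdd.exists
  exact (sq_nonneg _).trans hx

lemma abs_inner_le {x v : EuclideanSpace ℝ (Fin d)} (hx : ‖x‖ ^ 2 ≤ B) (hv : ‖v‖ ≤ 1) :
    inner ℝ x v ^ 2 ≤ B := by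
  have h1 := abs_real_inner_le_norm x v
  have h2 : ‖x‖ * ‖v‖ ≤ ‖x‖ := mul_le_of_le_one_right (norm_nonneg _) hv
  calc inner ℝ x v ^ 2 = |inner ℝ x v| ^ 2 := (sq_abs _).symm
    _ ≤ ‖x‖ ^ 2 := by gcongr; exact h1.trans h2
    _ ≤ B := hx

lemma integrable_cont [IsProbabilityMeasure μ] (h : RotBdd μ B) (f : EuclideanSpace ℝ (Fin d) → ℝ)
    (hf : Continuous f) : Integrable f μ := by
  have hc : IsCompact (Metric.closedBall (0 : EuclideanSpace ℝ (Fin d)) (√B)) :=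
    isCompact_closedBall _ _
  obtain ⟨C, hC⟩ := hc.exists_bound_of_continuousOn hf.continuousOn
  refine Integrable.of_bound hf.aestronglyMeasurable C ?_
  filter_upwards [h.bdd] with x hx
  apply hC
  rw [mem_closedBall_zero_iff]
  exact Real.le_sqrt_of_sq_le hx

lemma norm_sq_eq (x : EuclideanSpace ℝ (Fin d)) :
    ‖x‖ ^ 2 = ∑ j, inner ℝ x (EuclideanSpace.basisFun (Fin d) ℝ j) ^ 2 := by
  rw [EuclideanSpace.norm_sq_eq]
  simp [EuclideanSpace.basisFun_apply, EuclideanSpace.inner_single_right]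

lemma second_moment [IsProbabilityMeasure μ] (h : RotBdd μ B) (hd : 1 ≤ d)
    (v : EuclideanSpace ℝ (Fin d)) (hv : ‖v‖ = 1) :
    ∫ x, inner ℝ x v ^ 2 ∂μ = (∫ x, ‖x‖ ^ 2 ∂μ) / d := by
  have hd' : (d : ℝ) ≠ 0 := by positivity
  rw [eq_div_iff hd']
  have : ∫ x, ‖x‖ ^ 2 ∂μ = ∑ j : Fin d, ∫ x, inner ℝ x v ^ 2 ∂μ := by
    simp_rw [norm_sq_eq]
    rw [integral_finsetSum _ (fun j _ => h.integrable_cont _ (by fun_prop))]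
    refine Finset.sum_congr rfl fun j _ => ?_
    exact h.integral_inner_eq (fun t => t ^ 2) _ _ (by simp [hv])
  rw [this]; simp [mul_comm]

lemma second_moment' [IsProbabilityMeasure μ] (h : RotBdd μ B) (hd : 1 ≤ d)
    (w : EuclideanSpace ℝ (Fin d)) :
    ∫ x, inner ℝ x w ^ 2 ∂μ = ‖w‖ ^ 2 * ((∫ x, ‖x‖ ^ 2 ∂μ) / d) := by
  by_cases hw : w = 0
  · simp [hw]
  have hw' : ‖w‖ ≠ 0 := by simpa using hw
  rw [← h.second_moment hd (‖w‖⁻¹ • w) (by rw [norm_smul]; simp [hw']), ← integral_const_mul]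
  congr 1; ext x
  rw [inner_smul_right]; field_simp

lemma fourth_moment [IsProbabilityMeasure μ] (h : RotBdd μ B) (hd : 1 ≤ d)
    (v : EuclideanSpace ℝ (Fin d)) (hv : ‖v‖ = 1) :
    ∫ x, inner ℝ x v ^ 4 ∂μ ≤ 3 * B ^ 2 / (d * (d + 2)) := by
  set m := ∫ x, inner ℝ x v ^ 4 ∂μ with hm
  let e := fun j => EuclideanSpace.basisFun (Fin d) ℝ j
  have he : ∀ j, ‖e j‖ = 1 := fun j => by simp [e]
  have hmv : ∀ w : EuclideanSpace ℝ (Fin d), ‖w‖ = 1 → ∫ x, inner ℝ x w ^ 4 ∂μ = m := fun w hw =>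
    h.integral_inner_eq (fun t => t ^ 4) w v (by rw [hv, hw])
  have hoff : ∀ j k, j ≠ k → ∫ x, inner ℝ x (e j) ^ 2 * inner ℝ x (e k) ^ 2 ∂μ = m / 3 := by
    intro j k hjk
    have ho : inner ℝ (e j) (e k) = 0 := by
      simp [e, EuclideanSpace.inner_single_left, hjk]
    have hn1 : ‖(√2)⁻¹ • (e j + e k)‖ = 1 := by
      have : ‖e j + e k‖ ^ 2 = 2 := by
        rw [norm_add_sq_real, he, he, ho]; norm_num
      rw [norm_smul, ← Real.sqrt_sq (norm_nonneg (e j + e k)), this]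
      simp [abs_of_nonneg (Real.sqrt_nonneg 2)]
    have hn2 : ‖(√2)⁻¹ • (e j - e k)‖ = 1 := by
      have : ‖e j - e k‖ ^ 2 = 2 := by
        rw [norm_sub_sq_real, he, he, ho]; norm_num
      rw [norm_smul, ← Real.sqrt_sq (norm_nonneg (e j - e k)), this]
      simp [abs_of_nonneg (Real.sqrt_nonneg 2)]
    have h4 : ((√2)⁻¹) ^ 4 = (1 / 4 : ℝ) := by
      rw [inv_pow, show (√2) ^ 4 = ((√2) ^ 2) ^ 2 by ring, Real.sq_sqrt (by norm_num)]; norm_num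
    have key : ∫ x, inner ℝ x (e j) ^ 2 * inner ℝ x (e k) ^ 2 ∂μ =
        ∫ x, (1 / 3 * (inner ℝ x ((√2)⁻¹ • (e j + e k)) ^ 4 + inner ℝ x ((√2)⁻¹ • (e j - e k)) ^ 4)
          - 1 / 6 * (inner ℝ x (e j) ^ 4 + inner ℝ x (e k) ^ 4)) ∂μ := by
      congr 1; ext x
      rw [inner_smul_right, inner_smul_right, inner_add_right, inner_sub_right, mul_pow, mul_pow, h4]
      ring
    have I : ∀ w : EuclideanSpace ℝ (Fin d), Integrable (fun x => inner ℝ x w ^ 4) μ :=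
      fun w => h.integrable_cont _ (by fun_prop)
    rw [key, integral_sub (h.integrable_cont _ (by fun_prop)) (h.integrable_cont _ (by fun_prop)),
      integral_const_mul, integral_const_mul, integral_add (I _) (I _), integral_add (I _) (I _),
      hmv _ hn1, hmv _ hn2, hmv _ (he j), hmv _ (he k)]
    ring
  have hdiag : ∀ j, ∫ x, inner ℝ x (e j) ^ 2 * inner ℝ x (e j) ^ 2 ∂μ = m := by
    intro j
    rw [← hmv _ (he j)]
    congr 1; ext x; ring
  have htot : ∫ x, ‖x‖ ^ 4 ∂μ = d * (d + 2) * m / 3 := by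
    have : ∀ x : EuclideanSpace ℝ (Fin d), ‖x‖ ^ 4 = ∑ j, ∑ k, inner ℝ x (e j) ^ 2 * inner ℝ x (e k) ^ 2 := by
      intro x
      rw [← Finset.sum_mul_sum, show ‖x‖ ^ 4 = ‖x‖ ^ 2 * ‖x‖ ^ 2 by ring, norm_sq_eq]
    simp_rw [this]
    rw [integral_finsetSum _ (fun j _ => h.integrable_cont _ (by fun_prop))]
    have : ∀ j, ∫ x, ∑ k, inner ℝ x (e j) ^ 2 * inner ℝ x (e k) ^ 2 ∂μ = (d + 2) * m / 3 := by
      intro j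
      rw [integral_finsetSum _ (fun j _ => h.integrable_cont _ (by fun_prop))]
      have : ∀ k, ∫ x, inner ℝ x (e j) ^ 2 * inner ℝ x (e k) ^ 2 ∂μ =
          m / 3 + if k = j then 2 * m / 3 else 0 := by
        intro k
        split_ifs with hk
        · rw [hk, hdiag]; ring
        · rw [hoff j k (Ne.symm hk)]; ring
      simp_rw [this]
      rw [Finset.sum_add_distrib]
      simp
      ring
    simp_rw [this]
    simp; ring
  have hle : ∫ x, ‖x‖ ^ 4 ∂μ ≤ B ^ 2 := by
    have : ∫ x, ‖x‖ ^ 4 ∂μ ≤ ∫ x, B ^ 2 ∂μ := by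
      refine integral_mono_ae (h.integrable_cont _ (by fun_prop)) (integrable_const _) ?_
      filter_upwards [h.bdd] with x hx
      have : ‖x‖ ^ 4 = (‖x‖ ^ 2) ^ 2 := by ring
      simp only [this]
      gcongr
    simpa using this
  have hd' : (0:ℝ) < d := by exact_mod_cast hd
  rw [le_div_iff₀ (by positivity)]
  rw [htot] at hle
  linarith

variable {n : ℕ}

lemma integral_pair [IsProbabilityMeasure μ] (h : RotBdd μ B) (hd : 1 ≤ d) (i i' : Fin n) (hi : i ≠ i') :
    ∫ x, inner ℝ (x i) (x i') ^ 2 ∂(Measure.pi fun _ : Fin n => μ) = (∫ x, ‖x‖ ^ 2 ∂μ) ^ 2 / d := by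
  have hind : IndepFun (fun x : Fin n → EuclideanSpace ℝ (Fin d) => x i) (fun x => x i')
      (Measure.pi fun _ : Fin n => μ) :=
    (iIndepFun_pi (μ := fun _ : Fin n => μ) (X := fun _ => id) (fun _ => aemeasurable_id)).indepFun hi
  have hmap := (indepFun_iff_map_prod_eq_prod_map_map (measurable_pi_apply i).aemeasurable
    (measurable_pi_apply i').aemeasurable).mp hind
  have e1 : ∀ i, Measure.map (fun x : Fin n → EuclideanSpace ℝ (Fin d) => x i) (Measure.pi fun _ : Fin n => μ) = μ :=
    fun i => (measurePreserving_eval (fun _ : Fin n => μ) i).map_eq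
  rw [e1, e1] at hmap
  have h1 : ∫ z : EuclideanSpace ℝ (Fin d) × EuclideanSpace ℝ (Fin d), inner ℝ z.1 z.2 ^ 2 ∂(μ.prod μ) =
      ∫ x, inner ℝ (x i) (x i') ^ 2 ∂(Measure.pi fun _ : Fin n => μ) := by
    rw [← hmap, integral_map (by fun_prop) (by fun_prop)]
  rw [← h1, integral_prod_symm]
  · simp only
    simp_rw [h.second_moment' hd]
    rw [integral_mul_const]
    ring
  · have hb1 : ∀ᵐ z : EuclideanSpace ℝ (Fin d) × EuclideanSpace ℝ (Fin d) ∂(μ.prod μ), ‖z.1‖ ^ 2 ≤ B :=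
      Measure.quasiMeasurePreserving_fst.ae h.bdd
    have hb2 : ∀ᵐ z : EuclideanSpace ℝ (Fin d) × EuclideanSpace ℝ (Fin d) ∂(μ.prod μ), ‖z.2‖ ^ 2 ≤ B :=
      Measure.quasiMeasurePreserving_snd.ae h.bdd
    refine Integrable.of_bound (by fun_prop) (B * B) ?_
    filter_upwards [hb1, hb2] with z h1 h2
    rw [Real.norm_eq_abs, abs_of_nonneg (sq_nonneg _)]
    calc inner ℝ z.1 z.2 ^ 2 = |inner ℝ z.1 z.2| ^ 2 := (sq_abs _).symm
      _ ≤ (‖z.1‖ * ‖z.2‖) ^ 2 := by gcongr; exact abs_real_inner_le_norm _ _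
      _ = ‖z.1‖ ^ 2 * ‖z.2‖ ^ 2 := by ring
      _ ≤ B * B := by gcongr; exact h.B_nonneg

lemma pi_bdd [IsProbabilityMeasure μ] (h : RotBdd μ B) :
    ∀ᵐ x ∂(Measure.pi fun _ : Fin n => μ), ∀ i, ‖x i‖ ^ 2 ≤ B := by
  rw [ae_all_iff]
  intro i
  exact (measurePreserving_eval (fun _ : Fin n => μ) i).quasiMeasurePreserving.ae h.bdd

lemma pi_integrable_cont [IsProbabilityMeasure μ] (h : RotBdd μ B)
    (f : (Fin n → EuclideanSpace ℝ (Fin d)) → ℝ)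
    (hf : Continuous f) : Integrable f (Measure.pi fun _ : Fin n => μ) := by
  have hc : IsCompact (Metric.closedBall (0 : Fin n → EuclideanSpace ℝ (Fin d)) (√B)) :=
    isCompact_closedBall _ _
  obtain ⟨C, hC⟩ := hc.exists_bound_of_continuousOn hf.continuousOn
  refine Integrable.of_bound hf.aestronglyMeasurable C ?_
  filter_upwards [h.pi_bdd] with x hx
  apply hC
  rw [mem_closedBall_zero_iff, pi_norm_le_iff_of_nonneg (Real.sqrt_nonneg _)]
  exact fun i => Real.le_sqrt_of_sq_le (hx i)

lemma integral_frob [IsProbabilityMeasure μ] (h : RotBdd μ B) (hd : 1 ≤ d) :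
    ∫ x, frob x (n * (∫ x, ‖x‖ ^ 2 ∂μ) / d) ∂(Measure.pi fun _ : Fin n => μ) ≤ n * B ^ 2 := by
  set T := ∫ x, ‖x‖ ^ 2 ∂μ with hT
  have hd' : (0:ℝ) < d := by exact_mod_cast hd
  set c := n * T / d with hc
  have e1 : ∀ i : Fin n, ∫ x, ‖x i‖ ^ 2 ∂(Measure.pi fun _ : Fin n => μ) = T := by
    intro i
    have := (measurePreserving_eval (fun _ : Fin n => μ) i)
    have h2 := integral_map (f := fun x : EuclideanSpace ℝ (Fin d) => ‖x‖ ^ 2) this.aemeasurable (by fun_prop)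
    rw [this.map_eq] at h2
    exact h2.symm
  have e2 : ∀ i i' : Fin n, ∫ x, inner ℝ (x i) (x i') ^ 2 ∂(Measure.pi fun _ : Fin n => μ) ≤
      T ^ 2 / d + if i' = i then B ^ 2 else 0 := by
    intro i i'
    split_ifs with hi
    · subst hi
      have : ∫ x, inner ℝ (x i') (x i') ^ 2 ∂(Measure.pi fun _ : Fin n => μ) ≤ ∫ x, B ^ 2 ∂(Measure.pi fun _ : Fin n => μ) := by
        refine integral_mono_ae (h.pi_integrable_cont _ (by fun_prop)) (integrable_const _) ?_
        filter_upwards [h.pi_bdd] with x hx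
        simp only [real_inner_self_eq_norm_sq]
        have := hx i'
        gcongr
      have h2 : ∫ x, B ^ 2 ∂(Measure.pi fun _ : Fin n => μ) = B ^ 2 := by simp
      have : 0 ≤ T ^ 2 / d := by positivity
      linarith
    · rw [h.integral_pair hd i i' (Ne.symm hi)]; simp [hT]
  unfold frob
  rw [integral_add (h.pi_integrable_cont _ (by fun_prop)) (integrable_const _),
    integral_sub (h.pi_integrable_cont _ (by fun_prop)) (h.pi_integrable_cont _ (by fun_prop)),
    integral_finsetSum _ (fun j _ => h.pi_integrable_cont _ (by fun_prop)),
    integral_const_mul, integral_finsetSum _ (fun j _ => h.pi_integrable_cont _ (by fun_prop))]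
  simp_rw [e1]
  have e3 : ∑ i : Fin n, ∫ x, ∑ i', inner ℝ (x i) (x i') ^ 2 ∂(Measure.pi fun _ : Fin n => μ) ≤
      ∑ i : Fin n, (n * (T ^ 2 / d) + B ^ 2) := by
    refine Finset.sum_le_sum fun i _ => ?_
    rw [integral_finsetSum _ (fun j _ => h.pi_integrable_cont _ (by fun_prop))]
    refine (Finset.sum_le_sum fun i' _ => e2 i i').trans ?_
    rw [Finset.sum_add_distrib]
    simp
  simp only [Finset.sum_const, Finset.card_univ, Fintype.card_fin, nsmul_eq_mul, integral_const,
    smul_eq_mul, probReal_univ, one_mul] at e3 ⊢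
  have : (n:ℝ) * (n * (T ^ 2 / d)) - 2 * c * (n * T) + c ^ 2 * d = 0 := by
    rw [hc]; field_simp; ring
  linarith

/-- Chebyshev -/
lemma frob_tail [IsProbabilityMeasure μ] (h : RotBdd μ B) (hd : 1 ≤ d) (s : ℝ) (hs : 0 < s) :
    (Measure.pi fun _ : Fin n => μ).real {x | s ≤ frob x (n * (∫ x, ‖x‖ ^ 2 ∂μ) / d)} ≤ n * B ^ 2 / s := by
  rw [le_div_iff₀ hs, mul_comm]
  refine (mul_meas_ge_le_integral_of_nonneg (Filter.Eventually.of_forall fun x => frob_nonneg _ _)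
    (h.pi_integrable_cont _ (by unfold frob; fun_prop)) s).trans (h.integral_frob hd)

end RotBdd


/-- deviation operator -/
def devOp {d n : ℕ} (x : Fin n → EuclideanSpace ℝ (Fin d)) (c : ℝ) :
    EuclideanSpace ℝ (Fin d) →L[ℝ] EuclideanSpace ℝ (Fin d) := frameOperator x - c • 1

lemma devOp_inner {d n : ℕ} (x : Fin n → EuclideanSpace ℝ (Fin d)) (c : ℝ)
    (v w : EuclideanSpace ℝ (Fin d)) :
    inner ℝ (devOp x c v) w = ∑ i, inner ℝ (x i) v * inner ℝ (x i) w - c * inner ℝ v w := by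
  simp [devOp, frameOperator_apply, inner_sub_left, sum_inner, inner_smul_left]

lemma devOp_qf {d n : ℕ} (x : Fin n → EuclideanSpace ℝ (Fin d)) (c : ℝ)
    (v : EuclideanSpace ℝ (Fin d)) :
    inner ℝ (devOp x c v) v = ∑ i, inner ℝ (x i) v ^ 2 - c * ‖v‖ ^ 2 := by
  rw [devOp_inner, real_inner_self_eq_norm_sq]
  congr 1
  exact Finset.sum_congr rfl fun i _ => by ring

lemma devOp_symm {d n : ℕ} (x : Fin n → EuclideanSpace ℝ (Fin d)) (c : ℝ) :
    (devOp x c).IsSymmetric := by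
  intro v w
  change inner ℝ (devOp x c v) w = inner ℝ v (devOp x c w)
  rw [real_inner_comm (devOp x c w) v, devOp_inner, devOp_inner, real_inner_comm v w]
  congr 1
  exact Finset.sum_congr rfl fun i _ => by ring

lemma devOp_norm_le {d n : ℕ} (x : Fin n → EuclideanSpace ℝ (Fin d)) (c K : ℝ) (hK : 0 ≤ K)
    (h : ∀ v, ‖v‖ = 1 → |inner ℝ (devOp x c v) v| ≤ K) : ‖devOp x c‖ ≤ K := by
  rw [ContinuousLinearMap.norm_eq_iSup_rayleighQuotient _ (devOp_symm x c)]
  refine ciSup_le fun v => ?_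
  by_cases hv : v = 0
  · simp [hv, hK]
  have hv' : ‖v‖ ≠ 0 := by simpa using hv
  have h1 := h (‖v‖⁻¹ • v) (by rw [norm_smul]; simp [hv'])
  rw [map_smul, inner_smul_left, inner_smul_right] at h1
  simp only [ContinuousLinearMap.rayleighQuotient, ContinuousLinearMap.reApplyInnerSelf_apply]
  have e : RCLike.re (inner ℝ (devOp x c v) v) / ‖v‖ ^ 2 =
      (starRingEnd ℝ) ‖v‖⁻¹ * (‖v‖⁻¹ * inner ℝ (devOp x c v) v) := by
    simp
    field_simp
  rw [e]
  exact h1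

/-- grid point -/
def netPt {d : ℕ} (k : Fin d → Fin (2 * d + 1)) : EuclideanSpace ℝ (Fin d) :=
  WithLp.toLp 2 fun j => (((k j).val : ℝ) - d) / d

lemma exists_netPt {d : ℕ} (hd : 100 ≤ d) (v : EuclideanSpace ℝ (Fin d)) (hv : ‖v‖ = 1) :
    ∃ k, ‖v - netPt k‖ ≤ 1 / 10 := by
  have hd' : (100:ℝ) ≤ d := by exact_mod_cast hd
  have hd0 : (0:ℝ) < d := by linarith
  have hvj : ∀ j, |v j| ≤ 1 := fun j => by
    rw [← hv, ← Real.norm_eq_abs]; exact PiLp.norm_apply_le v j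
  have hex : ∀ j, ∃ k : Fin (2 * d + 1), |v j - ((k.val : ℝ) - d) / d| ≤ 1 / d := by
    intro j
    have h1 := abs_le.mp (hvj j)
    have h0 : 0 ≤ (d:ℝ) * v j + d := by nlinarith
    have hf := Nat.floor_le h0
    have hf2 := Nat.lt_floor_add_one ((d:ℝ) * v j + d)
    have hlt : ⌊(d:ℝ) * v j + d⌋₊ < 2 * d + 1 := by
      rw [Nat.lt_succ_iff]
      apply Nat.floor_le_of_le
      push_cast
      nlinarith
    refine ⟨⟨_, hlt⟩, ?_⟩
    simp only
    set f := (⌊(d:ℝ) * v j + d⌋₊ : ℝ)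
    have : v j - (f - d) / d = (d * v j + d - f) / d := by field_simp; ring
    rw [this, abs_div, abs_of_pos hd0]
    gcongr
    rw [abs_le]; constructor <;> linarith
  choose k hk using hex
  refine ⟨k, ?_⟩
  apply le_of_sq_le_sq _ (by norm_num)
  rw [EuclideanSpace.norm_sq_eq]
  calc ∑ j, ‖(v - netPt k) j‖ ^ 2 ≤ ∑ j : Fin d, (1 / (d:ℝ)) ^ 2 := by
        refine Finset.sum_le_sum fun j _ => ?_
        rw [Real.norm_eq_abs]
        have := hk j
        simp only [netPt, PiLp.sub_apply]
        gcongr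
    _ = 1 / d := by simp; field_simp
    _ ≤ (1 / 10) ^ 2 := by
        rw [div_le_iff₀ hd0]; linarith

lemma devOp_norm_le_net {d n : ℕ} (hd : 100 ≤ d) (x : Fin n → EuclideanSpace ℝ (Fin d)) (c τ : ℝ)
    (h : ∀ k : Fin d → Fin (2 * d + 1), ‖netPt k‖ ≤ 1.1 → |inner ℝ (devOp x c (netPt k)) (netPt k)| ≤ τ)
    (hτ : 0 ≤ τ) :
    ‖devOp x c‖ ≤ τ / 0.79 := by
  set A := devOp x c
  have h1 : ‖A‖ ≤ τ + 0.21 * ‖A‖ := by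
    refine devOp_norm_le x c _ (by positivity) fun v hv => ?_
    obtain ⟨k, hk⟩ := exists_netPt hd v hv
    set w := netPt k
    have hw : ‖w‖ ≤ 1.1 := by
      have := norm_sub_norm_le w v
      rw [norm_sub_rev] at this
      rw [hv] at this; linarith
    have e : inner ℝ (A v) v = inner ℝ (A w) w + inner ℝ (A (v - w)) v + inner ℝ (A w) (v - w) := by
      rw [map_sub, inner_sub_left, inner_sub_right]; ring
    have b1 : |inner ℝ (A (v - w)) v| ≤ ‖A‖ * 0.1 := by
      refine (abs_real_inner_le_norm _ _).trans ?_
      rw [hv, mul_one]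
      refine (A.le_opNorm _).trans ?_
      gcongr; linarith
    have b2 : |inner ℝ (A w) (v - w)| ≤ ‖A‖ * 1.1 * 0.1 := by
      refine (abs_real_inner_le_norm _ _).trans ?_
      have h2 := (A.le_opNorm w)
      have h3 : ‖A w‖ ≤ ‖A‖ * 1.1 := h2.trans (by gcongr)
      gcongr; linarith
    have b0 := h k hw
    change |inner ℝ (A v) v| ≤ _
    rw [e]
    refine (abs_add_three _ _ _).trans ?_
    linarith
  rw [le_div_iff₀ (by norm_num)]
  linarith

lemma devOp_norm_sq_le_frob {d n : ℕ} (x : Fin n → EuclideanSpace ℝ (Fin d)) (c : ℝ) :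
    ‖devOp x c‖ ≤ √(frob x c) := by
  refine ContinuousLinearMap.opNorm_le_bound _ (Real.sqrt_nonneg _) fun v => ?_
  let b := EuclideanSpace.basisFun (Fin d) ℝ
  apply le_of_sq_le_sq _ (by positivity)
  rw [mul_pow, Real.sq_sqrt (frob_nonneg _ _), frob_eq x c b, ← b.sum_sq_inner_right (devOp x c v),
    ← b.sum_sq_inner_right v, Finset.sum_mul]
  refine Finset.sum_le_sum fun j _ => ?_
  have e : inner ℝ (b j) (devOp x c v) = ∑ k, (∑ i, inner ℝ (b j) (x i) * inner ℝ (b k) (x i)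
      - if j = k then c else 0) * inner ℝ (b k) v := by
    rw [real_inner_comm, devOp_inner]
    simp_rw [sub_mul]
    rw [Finset.sum_sub_distrib]
    congr 1
    · simp_rw [Finset.sum_mul]
      rw [Finset.sum_comm]
      refine Finset.sum_congr rfl fun i _ => ?_
      rw [← b.sum_inner_mul_inner (x i) v, Finset.sum_mul]
      refine Finset.sum_congr rfl fun k _ => ?_
      rw [real_inner_comm (x i) (b j), real_inner_comm (x i) (b k)]
      ring
    · simp [real_inner_comm]
  rw [e]
  exact Finset.sum_mul_sq_le_sq_mul_sq _ _ _

namespace RotBdd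
variable {d n : ℕ} {μ : Measure (EuclideanSpace ℝ (Fin d))} {B : ℝ}

lemma mgf_le [IsProbabilityMeasure μ] (h : RotBdd μ B) (hd : 1 ≤ d)
    (v : EuclideanSpace ℝ (Fin d)) (hv : ‖v‖ = 1) (s : ℝ) (hs : |s| * B ≤ 1) :
    ∫ x, exp (s * (inner ℝ x v ^ 2 - (∫ x, ‖x‖ ^ 2 ∂μ) / d)) ∂μ ≤
      exp (s ^ 2 * (3 * B ^ 2 / (d * (d + 2)))) := by
  set m := (∫ x, ‖x‖ ^ 2 ∂μ) / d with hm
  have hm2 := h.second_moment hd v hv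
  rw [← hm] at hm2
  have hB := h.B_nonneg
  have hI2 : Integrable (fun x => inner ℝ x v ^ 2) μ := h.integrable_cont _ (by fun_prop)
  have hI4 : Integrable (fun x => inner ℝ x v ^ 4) μ := h.integrable_cont _ (by fun_prop)
  have hm0 : 0 ≤ m := by rw [← hm2]; exact integral_nonneg fun x => sq_nonneg _
  have hmB : m ≤ B := by
    rw [← hm2]
    have : ∫ x, inner ℝ x v ^ 2 ∂μ ≤ ∫ x, B ∂μ := by
      refine integral_mono_ae hI2 (integrable_const _) ?_
      filter_upwards [h.bdd] with x hx using abs_inner_le hx hv.le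
    simpa using this
  have h1 : ∫ x, exp (s * (inner ℝ x v ^ 2 - m)) ∂μ ≤
      ∫ x, (1 + s * (inner ℝ x v ^ 2 - m) + s ^ 2 * (inner ℝ x v ^ 4 - 2 * m * inner ℝ x v ^ 2 + m ^ 2)) ∂μ := by
    refine integral_mono_ae (h.integrable_cont _ (by fun_prop)) (h.integrable_cont _ (by fun_prop)) ?_
    filter_upwards [h.bdd] with x hx
    have hy : inner ℝ x v ^ 2 ≤ B := abs_inner_le hx hv.le
    have hy0 := sq_nonneg (inner ℝ x v)
    have : |s * (inner ℝ x v ^ 2 - m)| ≤ 1 := by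
      rw [abs_mul]
      refine le_trans ?_ hs
      gcongr
      rw [abs_le]; constructor <;> linarith
    have h2 := (abs_le.mp (Real.abs_exp_sub_one_sub_id_le this)).2
    have e : (s * (inner ℝ x v ^ 2 - m)) ^ 2 = s ^ 2 * (inner ℝ x v ^ 4 - 2 * m * inner ℝ x v ^ 2 + m ^ 2) := by ring
    rw [e] at h2
    linarith
  refine h1.trans ?_
  have e2 : ∫ x, (1 + s * (inner ℝ x v ^ 2 - m) + s ^ 2 * (inner ℝ x v ^ 4 - 2 * m * inner ℝ x v ^ 2 + m ^ 2)) ∂μ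
      = 1 + s ^ 2 * (∫ x, inner ℝ x v ^ 4 ∂μ - m ^ 2) := by
    rw [integral_add (h.integrable_cont _ (by fun_prop)) (h.integrable_cont _ (by fun_prop)),
      integral_add (h.integrable_cont _ (by fun_prop)) (h.integrable_cont _ (by fun_prop)),
      integral_const_mul, integral_const_mul,
      integral_sub (h.integrable_cont _ (by fun_prop)) (h.integrable_cont _ (by fun_prop)),
      integral_add (h.integrable_cont _ (by fun_prop)) (h.integrable_cont _ (by fun_prop)),
      integral_sub (h.integrable_cont _ (by fun_prop)) (h.integrable_cont _ (by fun_prop)),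
      integral_const_mul, hm2]
    simp
    left; ring
  rw [e2]
  have h4 := h.fourth_moment hd v hv
  have : s ^ 2 * (∫ x, inner ℝ x v ^ 4 ∂μ - m ^ 2) ≤ s ^ 2 * (3 * B ^ 2 / (d * (d + 2))) := by
    gcongr
    linarith [sq_nonneg m]
  linarith [Real.add_one_le_exp (s ^ 2 * (3 * B ^ 2 / (d * (d + 2))))]

lemma chernoff_one [IsProbabilityMeasure μ] (h : RotBdd μ B) (hd : 1 ≤ d)
    (v : EuclideanSpace ℝ (Fin d)) (hv : ‖v‖ = 1) (s : ℝ) (hs : |s| * B ≤ 1) (a : ℝ) :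
    (Measure.pi fun _ : Fin n => μ).real {x | a ≤ s * (∑ i, inner ℝ (x i) v ^ 2 - n * (∫ x, ‖x‖ ^ 2 ∂μ) / d)} ≤
      exp (n * (s ^ 2 * (3 * B ^ 2 / (d * (d + 2)))) - a) := by
  set m := (∫ x, ‖x‖ ^ 2 ∂μ) / d with hm
  set M := 3 * B ^ 2 / ((d:ℝ) * (d + 2)) with hM
  have key : ∫ x, ∏ i, exp (s * (inner ℝ (x i) v ^ 2 - m)) ∂(Measure.pi fun _ : Fin n => μ) ≤
      exp (n * (s ^ 2 * M)) := by
    rw [integral_fintype_prod_eq_pow (fun x => exp (s * (inner ℝ x v ^ 2 - m))), Fintype.card_fin,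
      Real.exp_nat_mul]
    refine pow_le_pow_left₀ (integral_nonneg fun x => ?_) (h.mgf_le hd v hv s hs) _
    exact (exp_pos _).le
  have hp : ∀ x : Fin n → EuclideanSpace ℝ (Fin d), ∏ i, exp (s * (inner ℝ (x i) v ^ 2 - m)) =
      exp (s * (∑ i, inner ℝ (x i) v ^ 2 - n * (∫ x, ‖x‖ ^ 2 ∂μ) / d)) := by
    intro x
    rw [← Real.exp_sum, ← Finset.mul_sum, Finset.sum_sub_distrib]
    simp [hm]; left; ring
  simp_rw [hp] at key
  have hmk := mul_meas_ge_le_integral_of_nonneg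
    (f := fun x : Fin n → EuclideanSpace ℝ (Fin d) => exp (s * (∑ i, inner ℝ (x i) v ^ 2 - n * (∫ x, ‖x‖ ^ 2 ∂μ) / d)))
    (Filter.Eventually.of_forall fun x => (exp_pos _).le)
    (h.pi_integrable_cont _ (by fun_prop)) (exp a)
  simp_rw [Real.exp_le_exp] at hmk
  rw [Real.exp_sub, le_div_iff₀ (exp_pos _), mul_comm]
  exact hmk.trans key

lemma chernoff [IsProbabilityMeasure μ] (h : RotBdd μ B) (hd : 1 ≤ d)
    (v : EuclideanSpace ℝ (Fin d)) (hv : ‖v‖ = 1) (l : ℝ) (hl0 : 0 < l) (hs : l * B ≤ 1) (t : ℝ) :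
    (Measure.pi fun _ : Fin n => μ).real {x | t ≤ |∑ i, inner ℝ (x i) v ^ 2 - n * (∫ x, ‖x‖ ^ 2 ∂μ) / d|} ≤
      2 * exp (n * (l ^ 2 * (3 * B ^ 2 / (d * (d + 2)))) - l * t) := by
  have h1 := h.chernoff_one (n := n) hd v hv l (by rwa [abs_of_pos hl0]) (l * t)
  have h2 := h.chernoff_one (n := n) hd v hv (-l) (by rwa [abs_neg, abs_of_pos hl0]) (l * t)
  rw [neg_sq] at h2
  rw [two_mul]
  refine le_trans ?_ (add_le_add h1 h2)
  refine le_trans (measureReal_mono ?_) (measureReal_union_le _ _)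
  intro x hx
  simp only [Set.mem_ofPred_eq, Set.mem_union] at hx ⊢
  rcases le_abs.mp hx with h | h
  · left; gcongr
  · right
    have := mul_le_mul_of_nonneg_left h hl0.le
    linarith

lemma net_tail [IsProbabilityMeasure μ] (h : RotBdd μ B) (hd : 100 ≤ d)
    (l : ℝ) (hl0 : 0 < l) (hs : l * B ≤ 1) (g : ℝ) (hg : 0 < g) :
    (Measure.pi fun _ : Fin n => μ).real {x | g < ‖devOp x (n * (∫ x, ‖x‖ ^ 2 ∂μ) / d)‖} ≤
      (2 * d + 1) ^ d * (2 * exp (n * (l ^ 2 * (3 * B ^ 2 / (d * (d + 2)))) - l * (0.65 * g))) := by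
  set c := n * (∫ x, ‖x‖ ^ 2 ∂μ) / d with hc
  have hd1 : 1 ≤ d := by omega
  set R := 2 * exp (n * (l ^ 2 * (3 * B ^ 2 / (d * (d + 2)))) - l * (0.65 * g)) with hR
  have hR0 : 0 ≤ R := by positivity
  have hsub : {x : Fin n → EuclideanSpace ℝ (Fin d) | g < ‖devOp x c‖} ⊆
      ⋃ k : Fin d → Fin (2 * d + 1), {x | ‖netPt k‖ ≤ 1.1 ∧ 0.79 * g < |inner ℝ (devOp x c (netPt k)) (netPt k)|} := by
    intro x hx
    by_contra hcon
    simp only [Set.mem_iUnion, Set.mem_ofPred_eq, not_exists, not_and, not_lt] at hcon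
    have := devOp_norm_le_net hd x c (0.79 * g) hcon (by positivity)
    rw [mul_div_cancel_left₀ _ (by norm_num)] at this
    exact absurd hx (not_lt.mpr this)
  refine (measureReal_mono hsub).trans ((measureReal_iUnion_fintype_le _).trans ?_)
  have hk : ∀ k : Fin d → Fin (2 * d + 1), (Measure.pi fun _ : Fin n => μ).real
      {x | ‖netPt k‖ ≤ 1.1 ∧ 0.79 * g < |inner ℝ (devOp x c (netPt k)) (netPt k)|} ≤ R := by
    intro k
    by_cases hk0 : netPt k = 0
    · refine le_trans (le_of_eq ?_) hR0
      convert measureReal_empty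
      ext x
      simp [hk0]
      intro; positivity
    have hn0 : ‖netPt k‖ ≠ 0 := by simpa using hk0
    set v := ‖netPt k‖⁻¹ • netPt k with hv
    have hv1 : ‖v‖ = 1 := by rw [hv, norm_smul]; simp [hn0]
    refine le_trans (measureReal_mono ?_) (h.chernoff hd1 v hv1 l hl0 hs (0.65 * g))
    rintro x ⟨hx1, hx2⟩
    simp only [Set.mem_ofPred_eq]
    rw [← hc]
    have e : netPt k = ‖netPt k‖ • v := by rw [hv, smul_smul, mul_inv_cancel₀ hn0, one_smul]
    have e2 : inner ℝ (devOp x c (netPt k)) (netPt k) = ‖netPt k‖ ^ 2 * (∑ i, inner ℝ (x i) v ^ 2 - c) := by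
      conv_lhs => rw [e]
      rw [map_smul, inner_smul_left, inner_smul_right, devOp_qf, hv1]
      simp; ring
    rw [e2, abs_mul, abs_of_nonneg (sq_nonneg _)] at hx2
    have h3 : ‖netPt k‖ ^ 2 ≤ 1.1 ^ 2 := by gcongr
    have h4 := mul_le_mul_of_nonneg_right h3 (abs_nonneg (∑ i, inner ℝ (x i) v ^ 2 - c))
    linarith
  refine (Finset.sum_le_sum fun k _ => hk k).trans ?_
  simp
end RotBdd


/-- uniform measure on the shell -/
abbrev shellM (d n : ℕ) (ε : ℝ) : Measure (EuclideanSpace ℝ (Fin d)) :=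
  (volume : Measure (EuclideanSpace ℝ (Fin d)))[|sphericalShell d n ε]

/-- annulus with squared radii `r₁ρ, r₂ρ` -/
def annulus (d : ℕ) (ρ r₁ r₂ : ℝ) : Set (EuclideanSpace ℝ (Fin d)) :=
  {x | r₁ * ρ ≤ ‖x‖ ^ 2 ∧ ‖x‖ ^ 2 ≤ r₂ * ρ}

lemma annulus_meas (d : ℕ) (ρ r₁ r₂ : ℝ) : MeasurableSet (annulus d ρ r₁ r₂) := by
  apply IsClosed.measurableSet
  have h1 : IsClosed {x : EuclideanSpace ℝ (Fin d) | r₁ * ρ ≤ ‖x‖ ^ 2} :=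
    isClosed_le (by fun_prop) (by fun_prop)
  have h2 : IsClosed {x : EuclideanSpace ℝ (Fin d) | ‖x‖ ^ 2 ≤ r₂ * ρ} :=
    isClosed_le (by fun_prop) (by fun_prop)
  exact h1.inter h2

lemma annulus_vol {d : ℕ} (hd : 1 ≤ d) {ρ r₁ r₂ : ℝ} (hρ : 0 < ρ) (h1 : 0 ≤ r₁) (h12 : r₁ ≤ r₂) :
    volume.real (annulus d ρ r₁ r₂) =
      ((√ρ) ^ d * volume.real (Metric.ball (0 : EuclideanSpace ℝ (Fin d)) 1)) * ((√r₂) ^ d - (√r₁) ^ d) := by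
  have : Nonempty (Fin d) := ⟨⟨0, hd⟩⟩
  have e : annulus d ρ r₁ r₂ = Metric.closedBall 0 (√(r₂ * ρ)) \ Metric.ball 0 (√(r₁ * ρ)) := by
    ext x
    simp only [annulus, Set.mem_ofPred_eq, Set.mem_sdiff, mem_closedBall_zero_iff, mem_ball_zero_iff, not_lt]
    rw [Real.le_sqrt (norm_nonneg _), Real.sqrt_le_left (norm_nonneg _)]
    · exact and_comm
    · exact mul_nonneg (h1.trans h12) hρ.le
  have hsub : Metric.ball (0 : EuclideanSpace ℝ (Fin d)) (√(r₁ * ρ)) ⊆ Metric.closedBall 0 (√(r₂ * ρ)) := by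
    refine Metric.ball_subset_closedBall.trans (Metric.closedBall_subset_closedBall ?_)
    gcongr
  rw [e, measureReal_sdiff hsub Metric.isOpen_ball.measurableSet measure_closedBall_lt_top.ne]
  rw [measureReal_def, measureReal_def, Measure.addHaar_closedBall _ _ (Real.sqrt_nonneg _),
    Measure.addHaar_ball _ _ (Real.sqrt_nonneg _), ENNReal.toReal_mul, ENNReal.toReal_mul,
    ENNReal.toReal_ofReal (by positivity), ENNReal.toReal_ofReal (by positivity), finrank_euclideanSpace,
    Fintype.card_fin, Real.sqrt_mul (h1.trans h12), Real.sqrt_mul h1, mul_pow, mul_pow, ← measureReal_def]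
  ring

lemma sqrt_pow_eq {d : ℕ} {s : ℝ} (hs : 0 ≤ s) : (√s) ^ d = s ^ ((d : ℝ) / 2) := by
  rw [Real.rpow_div_two_eq_sqrt _ hs, Real.rpow_natCast]

lemma V_mid {d : ℕ} (hd : 2 ≤ d) {ε : ℝ} (h0 : 0 < ε) (h1 : ε < 1) :
    2 * (√1) ^ d ≤ (√(1 - ε)) ^ d + (√(1 + ε)) ^ d := by
  have hd' : (2:ℝ) ≤ d := by exact_mod_cast hd
  rw [Real.sqrt_one, one_pow, sqrt_pow_eq (by linarith), sqrt_pow_eq (s := 1 + ε) (by linarith)]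
  have a1 := one_add_mul_self_le_rpow_one_add (s := ε) (by linarith) (p := (d:ℝ) / 2) (by linarith)
  have a2 := one_add_mul_self_le_rpow_one_add (s := -ε) (by linarith) (p := (d:ℝ) / 2) (by linarith)
  rw [← sub_eq_add_neg] at a2
  linarith

lemma V_gap {d : ℕ} (hd : 2 ≤ d) {ε : ℝ} (h0 : 0 < ε) (h1 : ε < 1) :
    (√(1 - ε)) ^ d + (√(1 + ε)) ^ d ≤ 2 * (√(1 + ε - ε / (1 + d * ε))) ^ d := by
  have hd' : (2:ℝ) ≤ d := by exact_mod_cast hd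
  set w := ε / (1 + d * ε) with hw
  have hde : 0 < d * ε := by positivity
  have hw0 : 0 ≤ w := by positivity
  have hwε : w ≤ ε := div_le_self h0.le (by linarith)
  set b := 1 + ε with hb
  have hb0 : 0 < b := by linarith
  set p := (d:ℝ) / 2 with hp
  rw [sqrt_pow_eq (by linarith), sqrt_pow_eq (s := b) (by linarith), sqrt_pow_eq (s := b - w) (by linarith)]
  have hz : 2 * ε / b ≤ 1 := by rw [div_le_one hb0]; linarith
  have e1 : 1 - ε = b * (1 - 2 * ε / b) := by field_simp; ring
  have e2 : b - w = b * (1 - w / b) := by field_simp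
  have hwb : w / b ≤ 1 := by rw [div_le_one hb0]; linarith
  rw [e1, e2, Real.mul_rpow hb0.le (by linarith), Real.mul_rpow hb0.le (by linarith)]
  have hbp : 0 < b ^ p := by positivity
  have a2 := one_add_mul_self_le_rpow_one_add (s := -(w / b)) (by linarith) (p := p) (by linarith)
  rw [← sub_eq_add_neg] at a2
  have a1 : (1 - 2 * ε / b) ^ p ≤ 1 / (1 + p * (2 * ε / b)) := by
    have h3 : 1 - 2 * ε / b ≤ exp (-(2 * ε / b)) := by
      have := Real.add_one_le_exp (-(2 * ε / b)); linarith
    have h4 : (1 - 2 * ε / b) ^ p ≤ (exp (-(2 * ε / b))) ^ p :=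
      Real.rpow_le_rpow (by linarith) h3 (by linarith)
    rw [← Real.exp_mul] at h4
    refine h4.trans ?_
    rw [show -(2 * ε / b) * p = -(p * (2 * ε / b)) by ring, Real.exp_neg, ← one_div]
    have : 0 ≤ p * (2 * ε / b) := by positivity
    apply one_div_le_one_div_of_le (by linarith)
    linarith [Real.add_one_le_exp (p * (2 * ε / b))]
  have key : 1 + 1 / (1 + p * (2 * ε / b)) ≤ 2 * (1 + p * -(w / b)) := by
    have e3 : p * (2 * ε / b) = d * ε / b := by rw [hp]; field_simp
    have e4 : 1 / (1 + d * ε / b) = b / (b + d * ε) := by field_simp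
    have e5 : 2 * (1 + p * -(w / b)) = 2 - d * ε / (b * (1 + d * ε)) := by
      rw [hp, hw]; field_simp; ring
    rw [e3, e4, e5]
    have : d * ε / (b * (1 + d * ε)) ≤ d * ε / (b + d * ε) := by
      apply div_le_div_of_nonneg_left hde.le (by linarith)
      nlinarith
    have e6 : b / (b + d * ε) = 1 - d * ε / (b + d * ε) := by field_simp; ring
    linarith
  have : b ^ p * (1 + (1 - 2 * ε / b) ^ p) ≤ b ^ p * (2 * (1 - w / b) ^ p) := by
    gcongr
    linarith
  linarith

section
variable {d n : ℕ} {ε : ℝ}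

lemma shell_eq : sphericalShell d n ε = annulus d ((d:ℝ) / n) (1 - ε) (1 + ε) := rfl

lemma shell_meas : MeasurableSet (sphericalShell d n ε) := annulus_meas _ _ _ _

lemma V_lt (hd : 1 ≤ d) (h0 : 0 < ε) (h1 : ε < 1) : (√(1 - ε)) ^ d < (√(1 + ε)) ^ d := by
  refine pow_lt_pow_left₀ ?_ (Real.sqrt_nonneg _) (by omega)
  exact Real.sqrt_lt_sqrt (by linarith) (by linarith)

lemma K_pos (hd : 1 ≤ d) {ρ : ℝ} (hρ : 0 < ρ) :
    0 < (√ρ) ^ d * volume.real (Metric.ball (0 : EuclideanSpace ℝ (Fin d)) 1) := by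
  refine mul_pos (pow_pos (Real.sqrt_pos.mpr hρ) _) ?_
  exact ENNReal.toReal_pos (Metric.measure_ball_pos _ _ one_pos).ne' measure_ball_lt_top.ne

lemma rho_pos (hd : 1 ≤ d) (hn : d < n) : (0:ℝ) < d / n :=
  div_pos (by exact_mod_cast hd) (by exact_mod_cast (by omega : 0 < n))

lemma shell_vol_pos (hd : 1 ≤ d) (hn : d < n) (h0 : 0 < ε) (h1 : ε < 1) :
    0 < volume.real (sphericalShell d n ε) := by
  rw [shell_eq, annulus_vol hd (rho_pos hd hn) (by linarith) (by linarith)]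
  exact mul_pos (K_pos hd (rho_pos hd hn)) (sub_pos.mpr (V_lt hd h0 h1))

lemma shell_prob (hd : 1 ≤ d) (hn : d < n) (h0 : 0 < ε) (h1 : ε < 1) :
    IsProbabilityMeasure (shellM d n ε) := by
  have h := shell_vol_pos hd hn h0 h1
  have h2 := ENNReal.toReal_pos_iff.mp h
  exact cond_isProbabilityMeasure_of_finite h2.1.ne' h2.2.ne

lemma shell_ae : ∀ᵐ x ∂(shellM d n ε), x ∈ sphericalShell d n ε := ae_cond_mem shell_meas

lemma shell_inv (L : EuclideanSpace ℝ (Fin d) ≃ₗᵢ[ℝ] EuclideanSpace ℝ (Fin d)) :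
    MeasurePreserving L (shellM d n ε) (shellM d n ε) := by
  have h1 := (L.measurePreserving).restrict_preimage (s := sphericalShell d n ε) shell_meas
  have e : L ⁻¹' (sphericalShell d n ε) = sphericalShell d n ε := by
    ext x; simp [sphericalShell]
  rw [e] at h1
  exact h1.smul_measure _

lemma shell_rot : RotBdd (shellM d n ε) ((1 + ε) * ((d:ℝ) / n)) :=
  ⟨shell_inv, by filter_upwards [shell_ae] with x hx using hx.2⟩

lemma shell_T_ge (hd : 2 ≤ d) (hn : d < n) (h0 : 0 < ε) (h1 : ε < 1) :
    1 - ε / 2 ≤ n * (∫ x, ‖x‖ ^ 2 ∂(shellM d n ε)) / d := by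
  have := shell_prob (by omega) hn h0 h1
  set ρ := (d:ℝ) / n with hρ
  have hρ0 : 0 < ρ := rho_pos (by omega) hn
  have hP : 1 / 2 ≤ (shellM d n ε).real (annulus d ρ 1 (1 + ε)) := by
    rw [measureReal_def, cond_apply shell_meas, ENNReal.toReal_mul, ENNReal.toReal_inv, ← measureReal_def,
      ← measureReal_def]
    have e : sphericalShell d n ε ∩ annulus d ρ 1 (1 + ε) = annulus d ρ 1 (1 + ε) := by
      apply Set.inter_eq_right.mpr
      intro x hx
      exact ⟨by rw [← hρ]; nlinarith [hx.1], hx.2⟩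
    rw [e, shell_eq, ← hρ, annulus_vol (by omega) hρ0 (by linarith) (by linarith),
      annulus_vol (by omega) hρ0 (by linarith) (by linarith)]
    have hK := K_pos (d := d) (by omega) hρ0
    have hV := V_lt (d := d) (by omega) h0 h1
    have hm := V_mid hd h0 h1
    rw [← div_eq_inv_mul, mul_div_mul_left _ _ hK.ne', le_div_iff₀ (by linarith)]
    generalize (√(1:ℝ)) ^ d = t at *
    linarith
  have hI : ∫ x, ((1 - ε) * ρ + (annulus d ρ 1 (1 + ε)).indicator (fun _ => ε * ρ) x) ∂(shellM d n ε) ≤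
      ∫ x, ‖x‖ ^ 2 ∂(shellM d n ε) := by
    refine integral_mono_ae ((integrable_const _).add ((integrable_const _).indicator (annulus_meas _ _ _ _)))
      (shell_rot.integrable_cont _ (by fun_prop)) ?_
    filter_upwards [shell_ae] with x hx
    by_cases hxa : x ∈ annulus d ρ 1 (1 + ε)
    · rw [Set.indicator_of_mem hxa]; have := hxa.1; linarith
    · rw [Set.indicator_of_notMem hxa]; have := hx.1; rw [← hρ] at this; linarith
  rw [integral_add (integrable_const _) ((integrable_const _).indicator (annulus_meas _ _ _ _)),
    integral_indicator_const _ (annulus_meas _ _ _ _)] at hI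
  simp only [integral_const, probReal_univ, smul_eq_mul] at hI
  have e : (n:ℝ) * (∫ x, ‖x‖ ^ 2 ∂(shellM d n ε)) / d = (∫ x, ‖x‖ ^ 2 ∂(shellM d n ε)) / ρ := by
    rw [hρ]; field_simp
  rw [e, le_div_iff₀ hρ0]
  have : 0 < ε * ρ := by positivity
  nlinarith

lemma shell_T_le (hd : 2 ≤ d) (hn : d < n) (h0 : 0 < ε) (h1 : ε < 1) :
    n * (∫ x, ‖x‖ ^ 2 ∂(shellM d n ε)) / d ≤ 1 + ε - ε / (2 * (1 + d * ε)) := by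
  have := shell_prob (by omega) hn h0 h1
  set ρ := (d:ℝ) / n with hρ
  have hρ0 : 0 < ρ := rho_pos (by omega) hn
  set w := ε / (1 + d * ε) with hw
  have hde : 0 < d * ε := by positivity
  have hw0 : 0 ≤ w := by positivity
  have hwε : w ≤ ε := div_le_self h0.le (by linarith)
  have hP : 1 / 2 ≤ (shellM d n ε).real (annulus d ρ (1 - ε) (1 + ε - w)) := by
    rw [measureReal_def, cond_apply shell_meas, ENNReal.toReal_mul, ENNReal.toReal_inv, ← measureReal_def,
      ← measureReal_def]
    have e : sphericalShell d n ε ∩ annulus d ρ (1 - ε) (1 + ε - w) = annulus d ρ (1 - ε) (1 + ε - w) := by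
      apply Set.inter_eq_right.mpr
      intro x hx
      exact ⟨hx.1, by rw [← hρ]; nlinarith [hx.2]⟩
    rw [e, shell_eq, ← hρ, annulus_vol (by omega) hρ0 (by linarith) (by linarith),
      annulus_vol (by omega) hρ0 (by linarith) (by linarith)]
    have hK := K_pos (d := d) (by omega) hρ0
    have hV := V_lt (d := d) (by omega) h0 h1
    have hm := V_gap hd h0 h1
    rw [← hw] at hm
    rw [← div_eq_inv_mul, mul_div_mul_left _ _ hK.ne', le_div_iff₀ (by linarith)]
    linarith
  have hI : ∫ x, ‖x‖ ^ 2 ∂(shellM d n ε) ≤ ∫ x, ((1 + ε) * ρ - (annulus d ρ (1 - ε) (1 + ε - w)).indicator (fun _ => w * ρ) x) ∂(shellM d n ε) := by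
    refine integral_mono_ae (shell_rot.integrable_cont _ (by fun_prop))
      ((integrable_const _).sub ((integrable_const _).indicator (annulus_meas _ _ _ _))) ?_
    filter_upwards [shell_ae] with x hx
    by_cases hxa : x ∈ annulus d ρ (1 - ε) (1 + ε - w)
    · rw [Set.indicator_of_mem hxa]; have := hxa.2; linarith
    · rw [Set.indicator_of_notMem hxa]; have := hx.2; rw [← hρ] at this; linarith
  rw [integral_sub (integrable_const _) ((integrable_const _).indicator (annulus_meas _ _ _ _)),
    integral_indicator_const _ (annulus_meas _ _ _ _)] at hI
  simp only [integral_const, probReal_univ, smul_eq_mul] at hI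
  have e : (n:ℝ) * (∫ x, ‖x‖ ^ 2 ∂(shellM d n ε)) / d = (∫ x, ‖x‖ ^ 2 ∂(shellM d n ε)) / ρ := by
    rw [hρ]; field_simp
  have e2 : ε / (2 * (1 + d * ε)) = w / 2 := by rw [hw]; field_simp
  rw [e, e2, div_le_iff₀ hρ0]
  have : 0 ≤ w * ρ := by positivity
  nlinarith

end


/-- radial projection to the sphere of squared radius `ρ` -/
def radProj (d : ℕ) (ρ : ℝ) (x : EuclideanSpace ℝ (Fin d)) : EuclideanSpace ℝ (Fin d) :=
  (√ρ / ‖x‖) • x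

lemma radProj_meas (d : ℕ) (ρ : ℝ) : Measurable (radProj d ρ) := by
  unfold radProj
  fun_prop

lemma radProj_norm {d : ℕ} {ρ : ℝ} (hρ : 0 ≤ ρ) {x : EuclideanSpace ℝ (Fin d)} (hx : x ≠ 0) :
    ‖radProj d ρ x‖ ^ 2 = ρ := by
  have : ‖x‖ ≠ 0 := by simpa using hx
  rw [radProj, norm_smul, Real.norm_eq_abs, abs_of_nonneg (by positivity), div_mul_cancel₀ _ this,
    Real.sq_sqrt hρ]

section
variable {d n : ℕ} {ε : ℝ}

lemma ne_zero_of_shell (hd : 1 ≤ d) (hn : d < n) (h1 : ε < 1) {x : EuclideanSpace ℝ (Fin d)}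
    (hx : x ∈ sphericalShell d n ε) : x ≠ 0 := by
  rintro rfl
  have h2 := hx.1
  have := rho_pos hd hn
  rw [norm_zero] at h2
  nlinarith

lemma radProj_dist (hd : 1 ≤ d) (hn : d < n) (h0 : 0 < ε) (h1 : ε < 1) {x : EuclideanSpace ℝ (Fin d)}
    (hx : x ∈ sphericalShell d n ε) :
    ‖x - radProj d ((d:ℝ) / n) x‖ ^ 2 ≤ ε ^ 2 * ((d:ℝ) / n) := by
  have hρ := rho_pos hd hn
  have hx1 := hx.1
  have hx2 := hx.2
  set ρ := (d:ℝ) / n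
  have hx0 := ne_zero_of_shell hd hn h1 hx
  have hxn : 0 < ‖x‖ := by simpa using hx0
  have e : x - radProj d ρ x = (1 - √ρ / ‖x‖) • x := by rw [radProj, sub_smul, one_smul]
  rw [e, norm_smul, mul_pow, Real.norm_eq_abs, sq_abs]
  have e2 : (1 - √ρ / ‖x‖) ^ 2 * ‖x‖ ^ 2 = (‖x‖ - √ρ) ^ 2 := by field_simp
  rw [e2]
  have hs := Real.sq_sqrt hρ.le
  have hs0 : 0 < √ρ := Real.sqrt_pos.mpr hρ
  have h3 : (‖x‖ - √ρ) ^ 2 * (√ρ) ^ 2 ≤ (ε * ρ) ^ 2 := by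
    have h4 : |(‖x‖ - √ρ) * (‖x‖ + √ρ)| ≤ ε * ρ := by
      rw [show (‖x‖ - √ρ) * (‖x‖ + √ρ) = ‖x‖ ^ 2 - (√ρ) ^ 2 by ring, hs, abs_le]
      constructor <;> linarith
    rw [← mul_pow, ← sq_abs]
    refine pow_le_pow_left₀ (abs_nonneg _) (le_trans ?_ h4) 2
    rw [abs_mul, abs_mul]
    gcongr
    linarith
  rw [hs] at h3
  have : (‖x‖ - √ρ) ^ 2 * ρ ≤ (ε ^ 2 * ρ) * ρ := by linarith
  exact le_of_mul_le_mul_right this hρ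

/-- normalised uniform measure -/
abbrev normM (d n : ℕ) (ε : ℝ) : Measure (EuclideanSpace ℝ (Fin d)) :=
  (shellM d n ε).map (radProj d ((d:ℝ) / n))

lemma norm_ae (hd : 1 ≤ d) (hn : d < n) (h1 : ε < 1) :
    ∀ᵐ x ∂(normM d n ε), ‖x‖ ^ 2 = (d:ℝ) / n := by
  rw [ae_map_iff (radProj_meas _ _).aemeasurable (measurableSet_eq_fun (by fun_prop) (by fun_prop))]
  filter_upwards [shell_ae] with x hx
  exact radProj_norm (rho_pos hd hn).le (ne_zero_of_shell hd hn h1 hx)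

lemma norm_rot (hd : 1 ≤ d) (hn : d < n) (h1 : ε < 1) : RotBdd (normM d n ε) ((d:ℝ) / n) := by
  refine ⟨fun L => ⟨L.continuous.measurable, ?_⟩, ?_⟩
  · rw [Measure.map_map L.continuous.measurable (radProj_meas _ _)]
    have e : L ∘ radProj d ((d:ℝ) / n) = radProj d ((d:ℝ) / n) ∘ L := by
      ext1 x
      simp [radProj]
    rw [e, ← Measure.map_map (radProj_meas _ _) L.continuous.measurable, (shell_inv L).map_eq]
  · filter_upwards [norm_ae hd hn h1] with x hx using hx.le

lemma bad_le (hd : 1 ≤ d) (hn : d < n) (h0 : 0 < ε) (h1 : ε < 1) (s : ℝ) (hs : 0 < s) :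
    (Measure.pi fun _ : Fin n => shellM d n ε).real
      {x | s ≤ frob (fun i => radProj d ((d:ℝ) / n) (x i)) 1} ≤ n * ((d:ℝ) / n) ^ 2 / s := by
  have := shell_prob hd hn h0 h1
  have hp : IsProbabilityMeasure (normM d n ε) :=
    Measure.isProbabilityMeasure_map (radProj_meas _ _).aemeasurable
  have h := (norm_rot hd hn h1 (ε := ε)).frob_tail (n := n) hd s hs
  have hT : ∫ x, ‖x‖ ^ 2 ∂(normM d n ε) = (d:ℝ) / n := by
    rw [integral_congr_ae (norm_ae hd hn h1)]
    simp
  have hn0 : (n:ℝ) ≠ 0 := by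
    have : 0 < n := by omega
    positivity
  have hd0 : (d:ℝ) ≠ 0 := by positivity
  have hc : (n:ℝ) * ((d:ℝ) / n) / d = 1 := by field_simp
  rw [hT, hc] at h
  have hpm : (Measure.pi fun _ : Fin n => normM d n ε) =
      (Measure.pi fun _ : Fin n => shellM d n ε).map (fun x i => radProj d ((d:ℝ) / n) (x i)) :=
    (Measure.pi_map_pi (μ := fun _ : Fin n => shellM d n ε)
      (fun _ => (radProj_meas _ _).aemeasurable)).symm
  have hm : Measurable (fun (x : Fin n → EuclideanSpace ℝ (Fin d)) i => radProj d ((d:ℝ) / n) (x i)) :=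
    measurable_pi_lambda _ fun i => (radProj_meas _ _).comp (measurable_pi_apply i)
  rw [hpm, map_measureReal_apply hm] at h
  · exact h
  · apply IsClosed.measurableSet
    exact isClosed_le (by fun_prop) (by unfold frob; fun_prop)

lemma shell_pi_ae (hd : 1 ≤ d) (hn : d < n) (h0 : 0 < ε) (h1 : ε < 1) :
    ∀ᵐ x ∂(Measure.pi fun _ : Fin n => shellM d n ε), ∀ i, x i ∈ sphericalShell d n ε := by
  have := shell_prob hd hn h0 h1
  rw [ae_all_iff]
  intro i
  exact (measurePreserving_eval (fun _ : Fin n => shellM d n ε) i).quasiMeasurePreserving.ae shell_ae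

lemma const_ge : (34:ℝ) ≤ (√20 + √2) ^ 2 := by
  have h1 := Real.sq_sqrt (show (0:ℝ) ≤ 20 by norm_num)
  have h2 := Real.sq_sqrt (show (0:ℝ) ≤ 2 by norm_num)
  have h3 : (4.4:ℝ) ≤ √20 := Real.le_sqrt_of_sq_le (by norm_num)
  have h4 : (1.4:ℝ) ≤ √2 := Real.le_sqrt_of_sq_le (by norm_num)
  nlinarith

lemma good_of_frob (hd : 1 ≤ d) (hn : d < n) (h0 : 0 < ε) (h1 : ε < 1)
    (x : Fin n → EuclideanSpace ℝ (Fin d)) (hx : ∀ i, x i ∈ sphericalShell d n ε)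
    (hf : frob (fun i => radProj d ((d:ℝ) / n) (x i)) 1 ≤ 100 * ε ^ 4 / d) :
    paulsenDistSq x ≤ (√20 + √2) ^ 2 * ε ^ 2 * d := by
  have hd0 : (0:ℝ) < d := by positivity
  have hn0 : (n:ℝ) ≠ 0 := by
    have : 0 < n := by omega
    positivity
  have h := paulsen_le hd hn x (fun i => radProj d ((d:ℝ) / n) (x i))
    (fun i => radProj_norm (rho_pos hd hn).le (ne_zero_of_shell hd hn h1 (hx i)))
  refine h.trans ?_
  have a1 : ∑ i, ‖x i - radProj d ((d:ℝ) / n) (x i)‖ ^ 2 ≤ ε ^ 2 * d := by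
    refine (Finset.sum_le_sum fun i _ => radProj_dist hd hn h0 h1 (hx i)).trans (le_of_eq ?_)
    simp; field_simp
  have a2 : √(d * frob (fun i => radProj d ((d:ℝ) / n) (x i)) 1) ≤ 10 * ε ^ 2 := by
    rw [Real.sqrt_le_left (by positivity)]
    calc d * frob (fun i => radProj d ((d:ℝ) / n) (x i)) 1 ≤ d * (100 * ε ^ 4 / d) := by gcongr
      _ = (10 * ε ^ 2) ^ 2 := by field_simp; ring
  have a3 : 2 * d * √(d * frob (fun i => radProj d ((d:ℝ) / n) (x i)) 1) ≤ 2 * d * (10 * ε ^ 2) := by gcongr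
  have a4 : 34 * (ε ^ 2 * d) ≤ (√20 + √2) ^ 2 * (ε ^ 2 * d) := by
    gcongr; exact const_ge
  have : 0 ≤ ε ^ 2 * d := by positivity
  linarith

lemma good_trivial (hd : 1 ≤ d) (hn : d < n) (h0 : 0.26 ≤ ε) (h1 : ε < 1)
    (x : Fin n → EuclideanSpace ℝ (Fin d)) (hx : ∀ i, x i ∈ sphericalShell d n ε) :
    paulsenDistSq x ≤ (√20 + √2) ^ 2 * ε ^ 2 * d := by
  have hd0 : (0:ℝ) < d := by positivity
  have hn0 : (n:ℝ) ≠ 0 := by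
    have : 0 < n := by omega
    positivity
  obtain ⟨y, hy⟩ := enpf_nonempty hd hn
  have hy' : (fun i => - y i) ∈ equalNormParseval d n := by
    refine ⟨?_, fun i => by rw [norm_neg]; exact hy.2 i⟩
    rw [← hy.1]
    ext1 v
    simp [frameOperator_apply]
  have b1 := paulsen_le_of_mem x y hy
  have b2 := paulsen_le_of_mem x _ hy'
  have e : ∑ i, ‖x i - y i‖ ^ 2 + ∑ i, ‖x i - - y i‖ ^ 2 = 2 * ∑ i, ‖x i‖ ^ 2 + 2 * ∑ i, ‖y i‖ ^ 2 := by
    rw [← Finset.sum_add_distrib, Finset.mul_sum, Finset.mul_sum, ← Finset.sum_add_distrib]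
    refine Finset.sum_congr rfl fun i _ => ?_
    rw [sub_neg_eq_add, norm_sub_sq_real, norm_add_sq_real]; ring
  have s1 : ∑ i, ‖x i‖ ^ 2 ≤ (1 + ε) * d := by
    refine (Finset.sum_le_sum fun i _ => (hx i).2).trans (le_of_eq ?_)
    simp; field_simp
  have s2 : ∑ i, ‖y i‖ ^ 2 = d := by
    simp_rw [hy.2]; simp; field_simp
  have a4 : 34 * (ε ^ 2 * d) ≤ (√20 + √2) ^ 2 * (ε ^ 2 * d) := by
    gcongr; exact const_ge
  have a5 : (2 + ε) * d ≤ (34 * ε ^ 2) * d := by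
    gcongr
    nlinarith
  linarith

lemma frameOperator_cont : Continuous (frameOperator : (Fin n → EuclideanSpace ℝ (Fin d)) → _) := by
  unfold frameOperator
  refine continuous_finsetSum _ fun i _ => ?_
  have : Continuous fun x : Fin n → EuclideanSpace ℝ (Fin d) => innerSL ℝ (x i) :=
    (innerSL ℝ).continuous.comp (continuous_apply i)
  exact (ContinuousLinearMap.smulRightL ℝ (EuclideanSpace ℝ (Fin d)) (EuclideanSpace ℝ (Fin d))).continuous₂.comp₂ this (continuous_apply i)

lemma F_meas : MeasurableSet {x : Fin n → EuclideanSpace ℝ (Fin d) | ‖frameOperator x - 1‖ ≤ ε} := by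
  apply IsClosed.measurableSet
  have := frameOperator_cont (d := d) (n := n)
  exact isClosed_le (by fun_prop) (by fun_prop)

lemma F_pos (hd : 1 ≤ d) (hn : d < n) (h0 : 0 < ε) (h1 : ε < 1) :
    (Measure.pi fun _ : Fin n => shellM d n ε) {x | ‖frameOperator x - 1‖ ≤ ε} ≠ 0 := by
  have := shell_prob hd hn h0 h1
  obtain ⟨y, hy⟩ := enpf_nonempty hd hn
  have hρ := rho_pos hd hn
  have hc := frameOperator_cont (d := d) (n := n)
  have ho : IsOpen {x : Fin n → EuclideanSpace ℝ (Fin d) | ‖frameOperator x - 1‖ < ε} :=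
    isOpen_lt (by fun_prop) (by fun_prop)
  obtain ⟨δ, hδ, hb⟩ := Metric.isOpen_iff.mp ho y (by
    simp only [Set.mem_ofPred_eq]; rw [hy.1]; simpa using h0)
  have hpos : 0 < (Measure.pi fun _ : Fin n => shellM d n ε) (Metric.ball y δ) := by
    rw [Measure.pi_ball _ _ hδ]
    rw [pos_iff_ne_zero, Finset.prod_ne_zero_iff]
    intro i _
    rw [cond_apply shell_meas]
    refine mul_ne_zero ?_ ?_
    · rw [ENNReal.inv_ne_zero]
      exact ((ENNReal.toReal_pos_iff.mp (shell_vol_pos hd hn h0 h1)).2).ne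
    · have hop : IsOpen ({x : EuclideanSpace ℝ (Fin d) | (1 - ε) * ((d:ℝ) / n) < ‖x‖ ^ 2} ∩
          {x : EuclideanSpace ℝ (Fin d) | ‖x‖ ^ 2 < (1 + ε) * ((d:ℝ) / n)} ∩ Metric.ball (y i) δ) := by
        refine IsOpen.inter (IsOpen.inter ?_ ?_) Metric.isOpen_ball
        · exact isOpen_lt (by fun_prop) (by fun_prop)
        · exact isOpen_lt (by fun_prop) (by fun_prop)
      have hp := hop.measure_pos volume ⟨y i, ⟨by
        change (1 - ε) * ((d:ℝ) / n) < ‖y i‖ ^ 2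
        rw [hy.2 i]; nlinarith, by
        change ‖y i‖ ^ 2 < (1 + ε) * ((d:ℝ) / n)
        rw [hy.2 i]; nlinarith⟩, Metric.mem_ball_self hδ⟩
      refine (lt_of_lt_of_le hp (measure_mono ?_)).ne'
      rintro x ⟨⟨hx1, hx2⟩, hx3⟩
      exact ⟨⟨le_of_lt hx1, le_of_lt hx2⟩, hx3⟩
  refine (lt_of_lt_of_le hpos (measure_mono ?_)).ne'
  intro x hx
  have h2 : ‖frameOperator x - 1‖ < ε := hb hx
  exact h2.le

end


lemma log_ge_five {d : ℕ} (hd : 2 ≤ d) : 5 ≤ Real.log (80 * d) := by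
  have hd' : (2:ℝ) ≤ d := by exact_mod_cast hd
  rw [Real.le_log_iff_exp_le (by positivity)]
  have h1 : Real.exp 5 = (Real.exp 1) ^ 5 := by rw [← Real.exp_nat_mul]; norm_num
  have h2 : Real.exp 1 < 2.72 := Real.exp_one_lt_d9.trans (by norm_num)
  have h3 : (Real.exp 1) ^ 5 ≤ 2.72 ^ 5 := by gcongr
  rw [h1]
  refine h3.trans ?_
  norm_num
  linarith

section
variable {d n : ℕ} {ε : ℝ}

lemma gap_small (hd : 2 ≤ d) (hd2 : d < 100) (h0 : 0 < ε) (h1 : ε < 0.26)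
    {L : ℝ} (hL : 5 ≤ L) (hn0 : (0:ℝ) < n) (h : 2 * (d : ℝ) ^ 3 * L / ε ^ 4 ≤ n) :
    n * ((1 + ε) * ((d:ℝ) / n)) ^ 2 / (ε / (2 * (1 + d * ε))) ^ 2 ≤ 9 / 10 := by
  have hd' : (2:ℝ) ≤ d := by exact_mod_cast hd
  have hd2' : (d:ℝ) ≤ 100 := by exact_mod_cast hd2.le
  have e : n * ((1 + ε) * ((d:ℝ) / n)) ^ 2 / (ε / (2 * (1 + d * ε))) ^ 2 =
      4 * (1 + ε) ^ 2 * d ^ 2 * (1 + d * ε) ^ 2 / (n * ε ^ 2) := by field_simp; ring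
  rw [e, div_le_iff₀ (by positivity)]
  rw [div_le_iff₀ (by positivity)] at h
  have a1 : (1 + ε) ^ 2 ≤ 1.6 := by nlinarith
  have a2 : (1 + d * ε) ^ 2 ≤ (1 + d * 0.26) ^ 2 := by gcongr
  have a3 : (1 + (d:ℝ) * 0.26) ^ 2 ≤ 8.5 * d := by nlinarith
  have a4 : ε ^ 2 ≤ 0.07 := by nlinarith
  have a5 : 4 * (1 + ε) ^ 2 * d ^ 2 * (1 + d * ε) ^ 2 ≤ 4 * 1.6 * d ^ 2 * (8.5 * d) := by
    gcongr; exact a2.trans a3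
  have a6 : 10 * (d:ℝ) ^ 3 ≤ 2 * d ^ 3 * L := by nlinarith [pow_pos (show (0:ℝ) < d by linarith) 3]
  have a7 : 10 * (d:ℝ) ^ 3 ≤ (n * ε ^ 2) * ε ^ 2 := by
    calc 10 * (d:ℝ) ^ 3 ≤ n * ε ^ 4 := a6.trans h
      _ = (n * ε ^ 2) * ε ^ 2 := by ring
  have a8 : (n * ε ^ 2) * ε ^ 2 ≤ (n * ε ^ 2) * 0.07 := by gcongr
  have : (0:ℝ) < d ^ 3 := by positivity
  nlinarith

lemma gap_large (hd : 100 ≤ d) (h0 : 0 < ε) (h1 : ε < 0.26)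
    {L : ℝ} (hL : 5 ≤ L) (hLd : L = Real.log (80 * d)) (hn0 : (0:ℝ) < n)
    (h : 2 * (d : ℝ) ^ 3 * L / ε ^ 4 ≤ n) {g l B : ℝ} (hg : g = ε / (2 * (1 + d * ε)))
    (hl : l = n * (0.65 * g) / 9.54) (hB : B = (1 + ε) * ((d:ℝ) / n)) :
    l * B ≤ 1 ∧
    (2 * (d:ℝ) + 1) ^ d * (2 * exp (n * (l ^ 2 * (3 * B ^ 2 / (d * (d + 2)))) - l * (0.65 * g))) ≤ 9 / 10 := by
  have hd' : (100:ℝ) ≤ d := by exact_mod_cast hd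
  have hd0 : (0:ℝ) < d := by linarith
  have hg0 : 0 < g := by rw [hg]; positivity
  have hgd : g * d ≤ 1 / 2 := by
    rw [hg, div_mul_eq_mul_div, div_le_iff₀ (by positivity)]
    linarith [mul_pos hd0 h0]
  constructor
  · have : l * B = 0.65 / 9.54 * (1 + ε) * (g * d) := by rw [hl, hB]; field_simp
    rw [this]
    have : (1 + ε) * (g * d) ≤ 1.26 * (1 / 2) := by gcongr; linarith
    linarith
  set t := 0.65 * g with ht
  have ht0 : 0 < t := by positivity
  have b1 : 3 * B ^ 2 / (d * (d + 2)) ≤ 4.77 / n ^ 2 := by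
    rw [hB]
    have e : 3 * ((1 + ε) * ((d:ℝ) / n)) ^ 2 / (d * (d + 2)) = (3 * (1 + ε) ^ 2 * (d / (d + 2))) / n ^ 2 := by
      field_simp
    rw [e]
    gcongr
    have : (d:ℝ) / (d + 2) ≤ 1 := by rw [div_le_one (by positivity)]; linarith
    have h2 : 3 * (1 + ε) ^ 2 ≤ 4.77 := by nlinarith
    calc 3 * (1 + ε) ^ 2 * ((d:ℝ) / (d + 2)) ≤ 4.77 * 1 := by gcongr
      _ = 4.77 := by norm_num
  have b2 : n * (l ^ 2 * (3 * B ^ 2 / (d * (d + 2)))) - l * t ≤ - (n * t ^ 2 / 19.08) := by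
    have : n * (l ^ 2 * (3 * B ^ 2 / (d * (d + 2)))) ≤ n * (l ^ 2 * (4.77 / n ^ 2)) := by gcongr
    have e : n * (l ^ 2 * (4.77 / n ^ 2)) - l * t = - (n * t ^ 2 / 19.08) := by
      rw [hl]; field_simp; ring
    linarith
  have b3 : 42 * d * L ≤ n * t ^ 2 := by
    rw [div_le_iff₀ (by positivity)] at h
    have e : t ^ 2 = 0.65 ^ 2 / 4 * ε ^ 2 / (1 + d * ε) ^ 2 := by rw [ht, hg]; field_simp; norm_num
    rw [e, ← mul_div_assoc, le_div_iff₀ (by positivity)]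
    have c1 : ε * (1 + d * ε) ≤ 0.0702 * d := by
      have : 1 + d * ε ≤ 0.27 * d := by nlinarith
      calc ε * (1 + d * ε) ≤ 0.26 * (0.27 * d) := by gcongr
        _ = 0.0702 * d := by ring
    have c2 : (ε * (1 + d * ε)) ^ 2 ≤ (0.0702 * d) ^ 2 := by gcongr
    have c3 : ε ^ 2 * (42 * d * L * (1 + d * ε) ^ 2) ≤ ε ^ 2 * (n * (0.65 ^ 2 / 4 * ε ^ 2)) := by
      have c4 : 42 * d * L * (ε * (1 + d * ε)) ^ 2 ≤ 42 * d * L * (0.0702 * d) ^ 2 := by gcongr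
      have c5 : (0:ℝ) < d ^ 3 * L := by positivity
      calc ε ^ 2 * (42 * d * L * (1 + d * ε) ^ 2) = 42 * d * L * (ε * (1 + d * ε)) ^ 2 := by ring
        _ ≤ 42 * d * L * (0.0702 * d) ^ 2 := c4
        _ = (42 * 0.0702 ^ 2) * (d ^ 3 * L) := by ring
        _ ≤ (0.65 ^ 2 / 4 * 2) * (d ^ 3 * L) := mul_le_mul_of_nonneg_right (by norm_num) c5.le
        _ = (0.65 ^ 2 / 4) * (2 * d ^ 3 * L) := by ring
        _ ≤ (0.65 ^ 2 / 4) * (n * ε ^ 4) := by gcongr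
        _ = ε ^ 2 * (n * (0.65 ^ 2 / 4 * ε ^ 2)) := by ring
    exact le_of_mul_le_mul_left c3 (by positivity)
  have b4 : (2 * (d:ℝ) + 1) ^ d ≤ exp (d * L) := by
    rw [Real.exp_nat_mul, hLd, Real.exp_log (by positivity)]
    gcongr
    linarith
  have hdL : 500 ≤ d * L := by nlinarith
  have b5 : exp (n * (l ^ 2 * (3 * B ^ 2 / (d * (d + 2)))) - l * t) ≤ exp (- (2 * (d * L))) := by
    gcongr
    refine b2.trans ?_
    rw [neg_le_neg_iff, le_div_iff₀ (by norm_num)]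
    linarith
  calc (2 * (d:ℝ) + 1) ^ d * (2 * exp (n * (l ^ 2 * (3 * B ^ 2 / (d * (d + 2)))) - l * t))
      ≤ exp (d * L) * (2 * exp (- (2 * (d * L)))) := by gcongr
    _ = 2 * exp (-(d * L)) := by
        rw [mul_left_comm, ← Real.exp_add]; congr 2; ring
    _ ≤ 2 * (1 / 501) := by
        gcongr
        rw [Real.exp_neg, ← one_div]
        apply one_div_le_one_div_of_le (by norm_num)
        linarith [Real.add_one_le_exp (d * L)]
    _ ≤ 9 / 10 := by norm_num

lemma F_ge (hd : 2 ≤ d) (hn : d < n) (h0 : 0 < ε) (h1 : ε < 0.26)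
    (h : 2 * (d : ℝ) ^ 3 * Real.log (80 * d) / ε ^ 4 ≤ n) :
    1 / 10 ≤ (Measure.pi fun _ : Fin n => shellM d n ε).real {x | ‖frameOperator x - 1‖ ≤ ε} := by
  have hp := shell_prob (ε := ε) (by omega) hn h0 (by linarith)
  have hn0 : (0:ℝ) < n := by
    have : 0 < n := by omega
    positivity
  have hL := log_ge_five hd
  set c := n * (∫ x, ‖x‖ ^ 2 ∂(shellM d n ε)) / d with hc
  set g := ε / (2 * (1 + d * ε)) with hg
  have hg0 : 0 < g := by positivity
  have hgε : g ≤ ε / 2 := by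
    rw [hg]
    apply div_le_div_of_nonneg_left h0.le (by norm_num)
    have : 0 ≤ d * ε := by positivity
    linarith
  have hc1 : 1 - ε / 2 ≤ c := shell_T_ge hd hn h0 (by linarith)
  have hc2 : c ≤ 1 + ε - g := shell_T_le hd hn h0 (by linarith)
  have htail : (Measure.pi fun _ : Fin n => shellM d n ε).real {x | g < ‖devOp x c‖} ≤ 9 / 10 := by
    by_cases hd2 : d < 100
    · refine le_trans ?_ (gap_small hd hd2 h0 h1 hL hn0 h)
      refine le_trans (measureReal_mono ?_) ((shell_rot (d := d) (n := n) (ε := ε)).frob_tail (n := n) (by omega) (g ^ 2) (by positivity))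
      intro x hx
      have hx' : g < ‖devOp x c‖ := hx
      change g ^ 2 ≤ frob x c
      have h3 := hx'.le.trans (devOp_norm_sq_le_frob x c)
      exact (Real.le_sqrt' hg0).mp h3
    · have hd3 : 100 ≤ d := by omega
      obtain ⟨k1, k2⟩ := gap_large (n := n) hd3 h0 h1 hL rfl hn0 h hg rfl rfl
      exact ((shell_rot (d := d) (n := n) (ε := ε)).net_tail (n := n) hd3 _ (by positivity) k1 g hg0).trans k2
  have hcov : (Set.univ : Set (Fin n → EuclideanSpace ℝ (Fin d))) ⊆
      {x | g < ‖devOp x c‖} ∪ {x | ‖frameOperator x - 1‖ ≤ ε} := by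
    intro x _
    by_cases hx : g < ‖devOp x c‖
    · exact Or.inl hx
    right
    change ‖frameOperator x - 1‖ ≤ ε
    have e : frameOperator x - 1 = devOp x c + (c - 1) • (1 : EuclideanSpace ℝ (Fin d) →L[ℝ] EuclideanSpace ℝ (Fin d)) := by
      ext1 v; simp [devOp, sub_smul]
    have hone : ‖(1 : EuclideanSpace ℝ (Fin d) →L[ℝ] EuclideanSpace ℝ (Fin d))‖ ≤ 1 :=
      ContinuousLinearMap.norm_id_le
    have h4 : ‖(c - 1) • (1 : EuclideanSpace ℝ (Fin d) →L[ℝ] EuclideanSpace ℝ (Fin d))‖ ≤ ε - g := by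
      rw [norm_smul, Real.norm_eq_abs]
      refine (mul_le_of_le_one_right (abs_nonneg _) hone).trans ?_
      rw [abs_le]; constructor <;> linarith
    rw [e]
    refine (norm_add_le _ _).trans ?_
    linarith [not_lt.mp hx]
  have h5 := (measureReal_mono (μ := Measure.pi fun _ : Fin n => shellM d n ε) hcov).trans (measureReal_union_le _ _)
  rw [probReal_univ] at h5
  linarith

lemma main_bound (hd : 2 ≤ d) (h0 : 0 < ε) (h1 : ε < 1)
    (h : 2 * (d : ℝ) ^ 3 * Real.log (80 * d) / ε ^ 4 ≤ n) :
    ENNReal.ofReal 0.99 ≤ (nearlyENPFMeasure d n ε)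
          {x | paulsenDistSq x ≤ (Real.sqrt 20 + Real.sqrt 2) ^ 2 * ε ^ 2 * d} := by
  have hL := log_ge_five hd
  have hd' : (2:ℝ) ≤ d := by exact_mod_cast hd
  have hε4 : ε ^ 4 ≤ 1 := pow_le_one₀ h0.le h1.le
  have hnε : 10 * (d:ℝ) ^ 3 ≤ n * ε ^ 4 := by
    rw [div_le_iff₀ (by positivity)] at h
    nlinarith [pow_pos (show (0:ℝ) < d by linarith) 3]
  have hn : d < n := by
    have : n * ε ^ 4 ≤ (n:ℝ) := mul_le_of_le_one_right (by positivity) hε4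
    have h3 : (d:ℝ) < 10 * d ^ 3 := by nlinarith [mul_pos (show (0:ℝ) < d by linarith) (show (0:ℝ) < d by linarith)]
    exact_mod_cast (by linarith : (d:ℝ) < n)
  have hn0 : (0:ℝ) < n := by
    have : 0 < n := by omega
    positivity
  have hp := shell_prob (ε := ε) (by omega) hn h0 h1
  set P := Measure.pi fun _ : Fin n => shellM d n ε with hP
  have hF := F_pos (ε := ε) (by omega) hn h0 h1
  rw [← hP] at hF
  have hν : nearlyENPFMeasure d n ε = P[|{x | ‖frameOperator x - 1‖ ≤ ε}] := rfl
  have hνp : IsProbabilityMeasure (nearlyENPFMeasure d n ε) := by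
    rw [hν]; exact cond_isProbabilityMeasure hF
  have hae : ∀ᵐ x ∂(nearlyENPFMeasure d n ε), ∀ i, x i ∈ sphericalShell d n ε := by
    rw [hν]
    exact cond_absolutelyContinuous.ae_le (shell_pi_ae (by omega) hn h0 h1)
  apply ENNReal.ofReal_le_of_le_toReal
  rw [← measureReal_def]
  by_cases hε : 0.26 ≤ ε
  · have : ∀ᵐ x ∂(nearlyENPFMeasure d n ε), paulsenDistSq x ≤ (Real.sqrt 20 + Real.sqrt 2) ^ 2 * ε ^ 2 * d := by
      filter_upwards [hae] with x hx
      exact good_trivial (by omega) hn hε h1 x hx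
    have h2 : (nearlyENPFMeasure d n ε).real {x | paulsenDistSq x ≤ (Real.sqrt 20 + Real.sqrt 2) ^ 2 * ε ^ 2 * d} = 1 := by
      rw [measureReal_def, measure_congr (Filter.eventuallyEq_univ.mpr this)]
      simp
    rw [h2]; norm_num
  have hε' : ε < 0.26 := not_le.mp hε
  set bad : Set (Fin n → EuclideanSpace ℝ (Fin d)) :=
    {x | 100 * ε ^ 4 / d ≤ frob (fun i => radProj d ((d:ℝ) / n) (x i)) 1} with hbad
  have hb := bad_le (n := n) (by omega) hn h0 h1 (100 * ε ^ 4 / d) (by positivity)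
  rw [← hP, ← hbad] at hb
  have hb2 : P.real bad ≤ 1 / 1000 := by
    refine hb.trans ?_
    have e : n * ((d:ℝ) / n) ^ 2 / (100 * ε ^ 4 / d) = d ^ 3 / (100 * (n * ε ^ 4)) := by field_simp
    rw [e, div_le_iff₀ (by positivity)]
    linarith
  have hFge := F_ge hd hn h0 hε' h
  rw [← hP] at hFge
  have hνbad : (nearlyENPFMeasure d n ε).real bad ≤ 1 / 100 := by
    rw [hν, measureReal_def, cond_apply F_meas, ENNReal.toReal_mul, ENNReal.toReal_inv,
      ← measureReal_def, ← measureReal_def]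
    have h3 : P.real ({x | ‖frameOperator x - 1‖ ≤ ε} ∩ bad) ≤ 1 / 1000 :=
      (measureReal_mono Set.inter_subset_right).trans hb2
    rw [← div_eq_inv_mul, div_le_iff₀ (by linarith)]
    linarith
  have hcov : (nearlyENPFMeasure d n ε).real Set.univ ≤ (nearlyENPFMeasure d n ε).real
      ({x | paulsenDistSq x ≤ (Real.sqrt 20 + Real.sqrt 2) ^ 2 * ε ^ 2 * d} ∪ bad) := by
    rw [measureReal_def, measureReal_def]
    apply ENNReal.toReal_mono (measure_ne_top _ _)
    apply measure_mono_ae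
    filter_upwards [hae] with x hx _
    by_cases hxb : x ∈ bad
    · exact Or.inr hxb
    · left
      exact good_of_frob (by omega) hn h0 h1 x hx (not_le.mp hxb).le
  have h5 := hcov.trans (measureReal_union_le _ _)
  rw [probReal_univ] at h5
  linarith

end

theorem paulsen_concentration_sample_complexity
    (d : ℕ) (hd : 2 ≤ d) (ε : ℝ) (hε : ε ∈ Set.Ioo (0 : ℝ) 1) (n : ℕ) :
    ((2 * (d : ℝ) ^ 3 * Real.log (80 * d) / ε ^ 4 ≤ n) →
      (nearlyENPFMeasure d n ε)
          {x | paulsenDistSq x ≤ (Real.sqrt 20 + Real.sqrt 2) ^ 2 * ε ^ 2 * d}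
        ≥ ENNReal.ofReal 0.95) ∧
    ((2 * (d : ℝ) ^ 3 * Real.log (400 * d) / ε ^ 4 ≤ n) →
      (nearlyENPFMeasure d n ε)
          {x | paulsenDistSq x ≤ (Real.sqrt 20 + Real.sqrt 2) ^ 2 * ε ^ 2 * d}
        ≥ ENNReal.ofReal 0.99) := by
  obtain ⟨h0, h1⟩ := hε
  constructor
  · intro h
    exact (ENNReal.ofReal_le_ofReal (by norm_num)).trans (main_bound hd h0 h1 h)
  · intro h
    refine main_bound hd h0 h1 (le_trans ?_ h)
    have hd' : (0:ℝ) < d := by exact_mod_cast (by omega : 0 < d)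
    gcongr
    norm_num
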